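/- arXiv:2409.13672 — 14 statements merged into one kernel-verified Lean document; each statement's English description precedes it below -/
import Mathlib

section
/- Let X and Y be normed vector spaces over ℝ, let ρ ≥ 0, and let D : X → Y be a continuous function. If D is ρ-order Lipschitz continuous with constants C₀, C₁ ≥ 0, then D is ρ-integrated Lipschitz continuous (with the same constants C₀, C₁). -/
open Metric

/-- If `D` is `ρ`-order Lipschitz continuous with constants `C₀, C₁ ≥ 0`,
then `D` is `ρ`-integrated Lipschitz continuous with the same constants. -/
theorem rho_order_implies_rho_integrated
    {X Y : Type*} [NormedAddCommGroup X] [NormedSpace ℝ X]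
    [NormedAddCommGroup Y] [NormedSpace ℝ Y]
    (D : X → Y) (hD : Continuous D) (ρ C₀ C₁ : ℝ)
    (hρ : 0 ≤ ρ) (hC₀ : 0 ≤ C₀) (hC₁ : 0 ≤ C₁)
    (horder : ∀ x : X, ∃ r > 0, ∀ x₁ ∈ ball x r, ∀ x₂ ∈ ball x r,
      ‖D x₁ - D x₂‖ ≤ (C₀ + C₁ * ‖D x‖ ^ ρ) * ‖x₁ - x₂‖) :
    ∀ x₁ x₂ : X, ‖D x₁ - D x₂‖ ≤
      (C₀ + C₁ * ∫ t in (0:ℝ)..1, ‖D (x₁ + t • (x₂ - x₁))‖ ^ ρ) * ‖x₁ - x₂‖ := by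
  intro x₁ x₂
  set γ : ℝ → X := fun t => x₁ + t • (x₂ - x₁) with hγ
  have hγc : Continuous γ := by fun_prop
  have hpow : Continuous fun t => ‖D (γ t)‖ ^ ρ :=
    (hD.comp hγc).norm.rpow_const fun _ => Or.inr hρ
  set φ : ℝ → ℝ := fun t => (C₀ + C₁ * ‖D (γ t)‖ ^ ρ) * ‖x₁ - x₂‖ with hφ
  have hφc : Continuous φ := by fun_prop
  have hderiv : ∀ t, HasDerivAt (fun u => ∫ s in (0:ℝ)..u, φ s) (φ t) t := fun t =>
    intervalIntegral.integral_hasDerivAt_right (hφc.intervalIntegrable _ _)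
      (hφc.stronglyMeasurableAtFilter _ _) hφc.continuousAt
  have key := image_le_of_liminf_slope_right_le_deriv_boundary
    (f := fun t => ‖D (γ t) - D x₁‖) (a := 0) (b := 1)
    (B := fun u => ∫ s in (0:ℝ)..u, φ s) (B' := φ)
    ((hD.comp hγc).sub continuous_const).norm.continuousOn
    (by simp [hγ])
    (fun t _ => (hderiv t).continuousAt.continuousWithinAt)
    (fun t _ => (hderiv t).hasDerivWithinAt) ?_
    (Set.right_mem_Icc.2 (zero_le_one (α := ℝ)))
  · have hint : ∫ s in (0:ℝ)..1, φ s =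
        (C₀ + C₁ * ∫ t in (0:ℝ)..1, ‖D (γ t)‖ ^ ρ) * ‖x₁ - x₂‖ := by
      simp only [hφ]
      rw [intervalIntegral.integral_mul_const, intervalIntegral.integral_add
        (by simp) ((hpow.const_mul C₁).intervalIntegrable _ _),
        intervalIntegral.integral_const_mul]
      simp
    have h1 : γ 1 = x₂ := by simp [hγ]
    rw [hint, h1, norm_sub_rev] at key
    exact key
  · intro t _ r hr
    obtain ⟨δ, hδ, hball⟩ := horder (γ t)
    have hev : ∀ᶠ z in nhdsWithin t (Set.Ioi t), γ z ∈ ball (γ t) δ :=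
      (hγc.continuousAt.eventually (ball_mem_nhds _ hδ)).filter_mono nhdsWithin_le_nhds
    refine (hev.and self_mem_nhdsWithin).frequently.mono ?_
    rintro z ⟨hz, htz : t < z⟩
    have htz' : 0 < z - t := sub_pos.2 htz
    refine lt_of_le_of_lt ?_ hr
    have hsub : γ z - γ t = (z - t) • (x₂ - x₁) := by
      simp only [hγ]
      module
    have hb := hball _ hz _ (mem_ball_self hδ)
    rw [hsub, norm_smul, Real.norm_of_nonneg htz'.le, norm_sub_rev x₂ x₁] at hb
    have htri := norm_sub_norm_le (D (γ z) - D x₁) (D (γ t) - D x₁)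
    rw [sub_sub_sub_cancel_right] at htri
    rw [slope_def_field, div_le_iff₀ htz']
    simp only [hφ]
    linarith
end

section
/- Let X and Y be normed vector spaces over ℝ, let ρ ≥ 0, and let D : X → Y be a continuous function. If D is ρ-integrated Lipschitz continuous with constants C₀, C₁ ≥ 0, then D is ρ-order Lipschitz continuous: for every ε > 0 and every x ∈ X there exists an open ball B_x around x such that ‖D(x₁) − D(x₂)‖_Y ≤ (C₀ + C₁‖D(x)‖_Y^ρ + ε)‖x₁ − x₂‖_X for all x₁, x₂ ∈ B_x. -/
open Metric

/-- If `D` is `ρ`-integrated Lipschitz continuous with constants `C₀, C₁ ≥ 0`,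
then `D` is `ρ`-order Lipschitz continuous: for every `ε > 0` and every `x` there is an open
ball around `x` on which the local Lipschitz constant is `C₀ + C₁‖D x‖^ρ + ε`. -/
theorem rho_integrated_implies_rho_order
    {X Y : Type*} [NormedAddCommGroup X] [NormedSpace ℝ X]
    [NormedAddCommGroup Y] [NormedSpace ℝ Y]
    (D : X → Y) (hD : Continuous D) (ρ C₀ C₁ : ℝ)
    (hρ : 0 ≤ ρ) (hC₀ : 0 ≤ C₀) (hC₁ : 0 ≤ C₁)
    (hint : ∀ x₁ x₂ : X, ‖D x₁ - D x₂‖ ≤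
      (C₀ + C₁ * ∫ t in (0:ℝ)..1, ‖D (x₁ + t • (x₂ - x₁))‖ ^ ρ) * ‖x₁ - x₂‖) :
    ∀ ε > 0, ∀ x : X, ∃ r > 0, ∀ x₁ ∈ ball x r, ∀ x₂ ∈ ball x r,
      ‖D x₁ - D x₂‖ ≤ (C₀ + C₁ * ‖D x‖ ^ ρ + ε) * ‖x₁ - x₂‖ := by
  intro ε hε x
  have hg : Continuous fun y => C₁ * ‖D y‖ ^ ρ :=
    continuous_const.mul (hD.norm.rpow_const fun _ => Or.inr hρ)
  obtain ⟨r, hr, hball⟩ := Metric.eventually_nhds_iff_ball.1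
    (hg.continuousAt.eventually_lt (continuousAt_const (y := C₁ * ‖D x‖ ^ ρ + ε))
      (lt_add_of_pos_right _ hε))
  refine ⟨r, hr, fun x₁ h₁ x₂ h₂ => (hint x₁ x₂).trans ?_⟩
  have hsegment : Continuous fun t : ℝ => x₁ + t • (x₂ - x₁) := by fun_prop
  have hbound : C₁ * ∫ t in (0:ℝ)..1, ‖D (x₁ + t • (x₂ - x₁))‖ ^ ρ ≤ C₁ * ‖D x‖ ^ ρ + ε := by
    rw [← intervalIntegral.integral_const_mul]
    calc _ ≤ ∫ _ in (0:ℝ)..1, (C₁ * ‖D x‖ ^ ρ + ε) := by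
          refine intervalIntegral.integral_mono_on zero_le_one
            ((hg.comp hsegment).intervalIntegrable _ _) intervalIntegrable_const fun t ht => ?_
          exact (hball _ ((convex_ball x r).add_smul_sub_mem h₁ h₂ ht)).le
      _ = _ := by simp
  rw [add_assoc]
  gcongr
end

section
/- Let f : ℝ^p → ℝ be twice continuously differentiable and let ρ ≥ 0. If the gradient ∇f is ρ-order Lipschitz continuous with constants C₀, C₁ ≥ 0, then ‖∇²f(x)‖₂ ≤ C₀ + C₁‖∇f(x)‖₂^ρ for all x ∈ ℝ^p, where ‖∇²f(x)‖₂ denotes the spectral (operator) norm of the Hessian matrix. -/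
open Metric

/-- For a twice continuously differentiable `f : ℝ^p → ℝ`, if the gradient
`∇f` is `ρ`-order Lipschitz continuous with constants `C₀, C₁ ≥ 0`, then the spectral
(operator) norm of the Hessian satisfies `‖∇²f(x)‖ ≤ C₀ + C₁‖∇f(x)‖^ρ` for all `x`. -/
theorem hessian_bound_of_rho_order
    (p : ℕ) (f : EuclideanSpace ℝ (Fin p) → ℝ) (hf : ContDiff ℝ 2 f)
    (ρ C₀ C₁ : ℝ) (hρ : 0 ≤ ρ) (hC₀ : 0 ≤ C₀) (hC₁ : 0 ≤ C₁)
    (horder : ∀ x : EuclideanSpace ℝ (Fin p), ∃ r > 0, ∀ x₁ ∈ ball x r, ∀ x₂ ∈ ball x r,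
      ‖gradient f x₁ - gradient f x₂‖ ≤ (C₀ + C₁ * ‖gradient f x‖ ^ ρ) * ‖x₁ - x₂‖) :
    ∀ x : EuclideanSpace ℝ (Fin p),
      ‖fderiv ℝ (gradient f) x‖ ≤ C₀ + C₁ * ‖gradient f x‖ ^ ρ := by
  intro x
  obtain ⟨r, hr, hlip⟩ := horder x
  refine norm_fderiv_le_of_lip' ℝ (by positivity) ?_
  filter_upwards [ball_mem_nhds x hr] with y hy
  exact hlip y hy x (mem_ball_self hr)
end

section
/- Let f : ℝ^p → ℝ be twice continuously differentiable and let ρ ≥ 0. If there exist constants C₀, C₁ ≥ 0 such that ‖∇²f(x)‖₂ ≤ C₀ + C₁‖∇f(x)‖₂^ρ for all x ∈ ℝ^p (with ‖·‖₂ the spectral norm of the Hessian), then ∇f is ρ-order Lipschitz continuous: for every ε > 0 and every x ∈ ℝ^p there exists an open ball B_x around x such that ‖∇f(x₁) − ∇f(x₂)‖₂ ≤ (C₀ + C₁‖∇f(x)‖₂^ρ + ε)‖x₁ − x₂‖₂ for all x₁, x₂ ∈ B_x. -/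
open Metric

theorem ContDiff.gradient_right {F : Type*} [NormedAddCommGroup F] [InnerProductSpace ℝ F]
    [CompleteSpace F] {f : F → ℝ} {m n : WithTop ℕ∞} (hf : ContDiff ℝ n f) (hmn : m + 1 ≤ n) :
    ContDiff ℝ m (gradient f) :=
  (InnerProductSpace.toDual ℝ F).symm.contDiff.comp (hf.fderiv_right hmn)

/-- A `C¹` map is Lipschitz near `x` with any constant larger than the norm of its derivative
at `x`. -/
theorem ContDiff.exists_ball_norm_sub_le {E F : Type*} [NormedAddCommGroup E] [NormedSpace ℝ E]
    [NormedAddCommGroup F] [NormedSpace ℝ F] {g : E → F} (hg : ContDiff ℝ 1 g) {x : E} {K : ℝ}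
    (hK : ‖fderiv ℝ g x‖ < K) :
    ∃ r > 0, ∀ x₁ ∈ ball x r, ∀ x₂ ∈ ball x r, ‖g x₁ - g x₂‖ ≤ K * ‖x₁ - x₂‖ := by
  obtain ⟨r, hr, hball⟩ := Metric.eventually_nhds_iff_ball.1
    ((hg.continuous_fderiv one_ne_zero).norm.continuousAt.eventually_lt_const hK)
  exact ⟨r, hr, fun x₁ h₁ x₂ h₂ ↦ (convex_ball x r).norm_image_sub_le_of_norm_fderiv_le
    (fun y _ ↦ hg.differentiable one_ne_zero y) (fun y hy ↦ (hball y hy).le) h₂ h₁⟩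

/-- For a twice continuously differentiable `f : ℝ^p → ℝ`, if the spectral
(operator) norm of the Hessian satisfies `‖∇²f(x)‖ ≤ C₀ + C₁‖∇f(x)‖^ρ` for all `x` with
`C₀, C₁ ≥ 0`, then `∇f` is `ρ`-order Lipschitz continuous: for every `ε > 0` and every `x`
there is an open ball around `x` on which the Lipschitz constant is `C₀ + C₁‖∇f(x)‖^ρ + ε`. -/
theorem rho_order_of_hessian_bound
    (p : ℕ) (f : EuclideanSpace ℝ (Fin p) → ℝ) (hf : ContDiff ℝ 2 f)
    (ρ C₀ C₁ : ℝ) (hρ : 0 ≤ ρ) (hC₀ : 0 ≤ C₀) (hC₁ : 0 ≤ C₁)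
    (hhess : ∀ x : EuclideanSpace ℝ (Fin p),
      ‖fderiv ℝ (gradient f) x‖ ≤ C₀ + C₁ * ‖gradient f x‖ ^ ρ) :
    ∀ ε > 0, ∀ x : EuclideanSpace ℝ (Fin p), ∃ r > 0, ∀ x₁ ∈ ball x r, ∀ x₂ ∈ ball x r,
      ‖gradient f x₁ - gradient f x₂‖ ≤
        (C₀ + C₁ * ‖gradient f x‖ ^ ρ + ε) * ‖x₁ - x₂‖ := by
  intro ε hε x
  exact (hf.gradient_right (m := 1) (by norm_num)).exists_ball_norm_sub_le
    ((hhess x).trans_lt (lt_add_of_pos_right _ hε))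
end

section
/- For every ρ > 0 there exists a twice continuously differentiable function f : ℝ → ℝ such that the derivative f′ is ρ-order Lipschitz continuous but f′ is not globally Lipschitz continuous. -/
open Metric

/-- A `C¹` function satisfies a Lipschitz estimate near `x` with any constant exceeding
`|g' x|`. -/
lemma exists_ball_abs_sub_le_of_abs_deriv_lt {g : ℝ → ℝ} (hg : ContDiff ℝ 1 g) {x K : ℝ}
    (hK : |deriv g x| < K) :
    ∃ r > 0, ∀ x₁ ∈ ball x r, ∀ x₂ ∈ ball x r, |g x₁ - g x₂| ≤ K * |x₁ - x₂| := by
  have hc : Continuous fun y => |deriv g y| := (hg.continuous_deriv le_rfl).abs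
  obtain ⟨r, hr, hball⟩ := Metric.eventually_nhds_iff_ball.1 (hc.continuousAt.eventually_lt_const hK)
  refine ⟨r, hr, fun x₁ h₁ x₂ h₂ => ?_⟩
  exact (convex_ball x r).norm_image_sub_le_of_norm_deriv_le
    (fun y _ => (hg.differentiable one_ne_zero) y) (fun y hy => (hball y hy).le) h₂ h₁

/-- Every `C¹` function on `ℝ` is the derivative of a `C²` function. -/
lemma exists_contDiff_two_deriv_eq {g : ℝ → ℝ} (hg : ContDiff ℝ 1 g) :
    ∃ f : ℝ → ℝ, ContDiff ℝ 2 f ∧ deriv f = g := by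
  have hd : ∀ x, HasDerivAt (fun x => ∫ t in (0 : ℝ)..x, g t) (g x) x := fun x =>
    hg.continuous.integral_hasStrictDerivAt 0 x |>.hasDerivAt
  have he : deriv (fun x => ∫ t in (0 : ℝ)..x, g t) = g := funext fun x => (hd x).deriv
  refine ⟨_, ?_, he⟩
  rw [show (2 : WithTop ℕ∞) = 1 + 1 from one_add_one_eq_two.symm, contDiff_succ_iff_deriv, he]
  exact ⟨fun x => (hd x).differentiableAt, by simp, hg⟩

lemma contDiff_one_add_sq_rpow (a : ℝ) : ContDiff ℝ 1 fun x : ℝ => (1 + x ^ 2) ^ a :=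
  (contDiff_const.add (contDiff_id.pow 2)).rpow_const_of_ne fun x => by
    have : 0 < 1 + x ^ 2 := by positivity
    exact this.ne'

lemma abs_deriv_one_add_sq_rpow_le {ρ : ℝ} (hρ : 0 < ρ) (x : ℝ) :
    |deriv (fun x : ℝ => (1 + x ^ 2) ^ ((1 + ρ) / 2)) x| ≤
      (1 + ρ) * |(1 + x ^ 2) ^ ((1 + ρ) / 2)| ^ ρ := by
  have hpos : 0 < 1 + x ^ 2 := by positivity
  have hd : HasDerivAt (fun x : ℝ => (1 + x ^ 2) ^ ((1 + ρ) / 2))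
      (2 * x * ((1 + ρ) / 2) * (1 + x ^ 2) ^ ((1 + ρ) / 2 - 1)) x := by
    have h : HasDerivAt (fun x : ℝ => 1 + x ^ 2) (2 * x) x := by
      simpa using (hasDerivAt_pow 2 x).const_add 1
    exact h.rpow_const (Or.inl hpos.ne')
  have hx : |x| ≤ (1 + x ^ 2) ^ (1 / 2 : ℝ) := by
    rw [← Real.sqrt_eq_rpow]
    exact Real.abs_le_sqrt (by linarith)
  rw [hd.deriv, abs_of_pos (Real.rpow_pos_of_pos hpos _), ← Real.rpow_mul hpos.le, abs_mul,
    abs_of_pos (Real.rpow_pos_of_pos hpos _), abs_mul, abs_mul, abs_two,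
    abs_of_pos (show 0 < (1 + ρ) / 2 by positivity)]
  calc 2 * |x| * ((1 + ρ) / 2) * (1 + x ^ 2) ^ ((1 + ρ) / 2 - 1)
      = (1 + ρ) * (|x| * (1 + x ^ 2) ^ ((1 + ρ) / 2 - 1)) := by ring
    _ ≤ (1 + ρ) * ((1 + x ^ 2) ^ (1 / 2 : ℝ) * (1 + x ^ 2) ^ ((1 + ρ) / 2 - 1)) := by gcongr
    _ = (1 + ρ) * (1 + x ^ 2) ^ (1 / 2 + ((1 + ρ) / 2 - 1)) := by rw [Real.rpow_add hpos]
    _ ≤ (1 + ρ) * (1 + x ^ 2) ^ ((1 + ρ) / 2 * ρ) := by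
      gcongr
      · nlinarith [sq_nonneg x]
      · nlinarith

lemma not_lipschitz_one_add_sq_rpow {ρ : ℝ} (hρ : 0 < ρ) :
    ¬ ∃ C : ℝ, 0 ≤ C ∧ ∀ x₁ x₂ : ℝ,
      |(1 + x₁ ^ 2) ^ ((1 + ρ) / 2) - (1 + x₂ ^ 2) ^ ((1 + ρ) / 2)| ≤ C * |x₁ - x₂| := by
  rintro ⟨C, hC, h⟩
  obtain ⟨x, hx1, hx⟩ : ∃ x : ℝ, 1 ≤ x ∧ x ^ ρ = 2 + C :=
    ⟨(2 + C) ^ ρ⁻¹, Real.one_le_rpow (by linarith) (by positivity),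
      Real.rpow_inv_rpow (by linarith) hρ.ne'⟩
  have hx0 : 0 < x := by linarith
  have hlow : x * (2 + C) ≤ (1 + x ^ 2) ^ ((1 + ρ) / 2) :=
    calc x * (2 + C) = x ^ (1 + ρ) := by rw [Real.rpow_add hx0, Real.rpow_one, hx]
      _ = (x ^ 2) ^ ((1 + ρ) / 2) := by
        rw [← Real.rpow_natCast, ← Real.rpow_mul hx0.le]
        congr 1
        push_cast
        ring
      _ ≤ (1 + x ^ 2) ^ ((1 + ρ) / 2) := by
        gcongr
        linarith
  have hup := (le_abs_self _).trans (h x 0)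
  rw [sub_zero, abs_of_pos hx0] at hup
  norm_num at hup
  linarith

/-- For every `ρ > 0` there exists a twice continuously differentiable
`f : ℝ → ℝ` whose derivative `f'` is `ρ`-order Lipschitz continuous but not globally
Lipschitz continuous. -/
theorem exists_rho_order_not_globally_lipschitz (ρ : ℝ) (hρ : 0 < ρ) :
    ∃ f : ℝ → ℝ, ContDiff ℝ 2 f ∧
      (∃ C₀ C₁ : ℝ, 0 ≤ C₀ ∧ 0 ≤ C₁ ∧
        ∀ x : ℝ, ∃ r > 0, ∀ x₁ ∈ ball x r, ∀ x₂ ∈ ball x r,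
          |deriv f x₁ - deriv f x₂| ≤ (C₀ + C₁ * |deriv f x| ^ ρ) * |x₁ - x₂|) ∧
      ¬ (∃ C : ℝ, 0 ≤ C ∧ ∀ x₁ x₂ : ℝ, |deriv f x₁ - deriv f x₂| ≤ C * |x₁ - x₂|) := by
  have hg := contDiff_one_add_sq_rpow ((1 + ρ) / 2)
  obtain ⟨f, hf, hfg⟩ := exists_contDiff_two_deriv_eq hg
  refine ⟨f, hf, ?_⟩
  rw [hfg]
  refine ⟨⟨1, 1 + ρ, zero_le_one, by positivity, fun x => ?_⟩, not_lipschitz_one_add_sq_rpow hρ⟩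
  exact exists_ball_abs_sub_le_of_abs_deriv_lt hg
    ((abs_deriv_one_add_sq_rpow_le hρ x).trans_lt (lt_one_add _))
end

section
/- Define f : ℝ → ℝ by f(x) = e^{|x|} for |x| ≥ 1 and f(x) = (e/2)x² + e/2 for |x| < 1. Then f is twice continuously differentiable, its second derivative satisfies f″(x) = e^{|x|} for |x| ≥ 1 and f″(x) = e for |x| < 1 (so f″ is unbounded on ℝ), and for every ρ ≥ 1 the inequality |f″(x)| ≤ e + |f′(x)|^ρ holds for all x ∈ ℝ. -/
/-- A function that agrees with functions `u`, `v`, `w` on `(-∞, a]`, `[a, b]`, `[b, ∞)`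
has derivative `g x` at `x` if each of the three does on its own piece. -/
theorem hasDerivAt_of_eqOn_Iic_Icc_Ici {φ u v w g : ℝ → ℝ} {a b : ℝ}
    (hu : Set.EqOn φ u (Set.Iic a)) (hv : Set.EqOn φ v (Set.Icc a b))
    (hw : Set.EqOn φ w (Set.Ici b))
    (hu' : ∀ x ∈ Set.Iic a, HasDerivAt u (g x) x)
    (hv' : ∀ x ∈ Set.Icc a b, HasDerivAt v (g x) x)
    (hw' : ∀ x ∈ Set.Ici b, HasDerivAt w (g x) x) (x : ℝ) :
    HasDerivAt φ (g x) x := by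
  have piece : ∀ {s : Set ℝ} {ψ : ℝ → ℝ}, IsClosed s → Set.EqOn φ ψ s →
      (∀ y ∈ s, HasDerivAt ψ (g y) y) → HasDerivWithinAt φ (g x) s x := by
    intro s ψ hs h h'
    by_cases hx : x ∈ s
    · exact (h' x hx).hasDerivWithinAt.congr h (h hx)
    · exact hasDerivWithinAt_iff_hasFDerivWithinAt.2 (.of_notMem_closure (by rwa [hs.closure_eq]))
  have key := ((piece isClosed_Iic hu hu').union (piece isClosed_Icc hv hv')).union
    (piece isClosed_Ici hw hw')
  refine key.hasDerivAt (Filter.mem_of_superset Filter.univ_mem fun y _ => ?_)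
  simp only [Set.mem_union, Set.mem_Iic, Set.mem_Icc, Set.mem_Ici]
  grind

/-- The derivative of the function equal to `e^{|x|}` for `|x| ≥ 1` and to
`(e/2)x² + e/2` for `|x| < 1`. -/
noncomputable def expAbsDeriv (x : ℝ) : ℝ :=
  if x ≤ -1 then -Real.exp (-x) else if x ≤ 1 then Real.exp 1 * x else Real.exp x

theorem expAbsDeriv_of_le_neg_one {x : ℝ} (hx : x ≤ -1) : expAbsDeriv x = -Real.exp (-x) :=
  if_pos hx

theorem expAbsDeriv_of_mem_Icc {x : ℝ} (hx : x ∈ Set.Icc (-1) 1) :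
    expAbsDeriv x = Real.exp 1 * x := by
  rcases hx.1.eq_or_lt with rfl | h
  · simp [expAbsDeriv]
  · simp [expAbsDeriv, h.not_ge, hx.2]

theorem expAbsDeriv_of_one_le {x : ℝ} (hx : 1 ≤ x) : expAbsDeriv x = Real.exp x := by
  have h : ¬ x ≤ -1 := by linarith
  rcases hx.eq_or_lt with rfl | hx
  · simp [expAbsDeriv, h]
  · simp [expAbsDeriv, h, hx.not_ge]

theorem hasDerivAt_exp_neg (x : ℝ) : HasDerivAt (fun y => Real.exp (-y)) (-Real.exp (-x)) x := by
  simpa using (hasDerivAt_neg x).exp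

theorem hasDerivAt_expAbsDeriv (x : ℝ) :
    HasDerivAt expAbsDeriv (Real.exp (max |x| 1)) x := by
  refine hasDerivAt_of_eqOn_Iic_Icc_Ici (a := -1) (b := 1) (u := fun y => -Real.exp (-y))
    (v := fun y => Real.exp 1 * y) (w := Real.exp) (g := fun y => Real.exp (max |y| 1))
    (fun _ => expAbsDeriv_of_le_neg_one) (fun _ => expAbsDeriv_of_mem_Icc)
    (fun _ => expAbsDeriv_of_one_le) ?_ ?_ ?_ x
  · intro y (hy : y ≤ -1)
    have h : max |y| 1 = -y := by
      rw [abs_of_nonpos (by linarith), max_eq_left (by linarith)]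
    simpa [h] using (hasDerivAt_exp_neg y).fun_neg
  · intro y hy
    have h : max |y| 1 = 1 := max_eq_right (abs_le.2 hy)
    simpa [h] using (hasDerivAt_id y).const_mul (Real.exp 1)
  · intro y (hy : 1 ≤ y)
    have h : max |y| 1 = y := by
      rw [abs_of_nonneg (by linarith), max_eq_left hy]
    simpa [h] using Real.hasDerivAt_exp y

theorem abs_expAbsDeriv {x : ℝ} (hx : 1 ≤ |x|) : |expAbsDeriv x| = Real.exp |x| := by
  rcases le_abs.1 hx with h | h
  · rw [expAbsDeriv_of_one_le h, Real.abs_exp, abs_of_nonneg (by linarith : 0 ≤ x)]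
  · rw [expAbsDeriv_of_le_neg_one (by linarith), abs_neg, Real.abs_exp,
      abs_of_nonpos (by linarith : x ≤ 0)]

/-- The function `f(x) = e^{|x|}` for `|x| ≥ 1` and
`f(x) = (e/2)x² + e/2` for `|x| < 1` is twice continuously differentiable, its second
derivative is `e^{|x|}` for `|x| ≥ 1` and `e` for `|x| < 1` (hence unbounded on `ℝ`),
and for every `ρ ≥ 1`, `|f''(x)| ≤ e + |f'(x)|^ρ` for all `x`. -/
theorem exp_abs_example (f : ℝ → ℝ)
    (hf : ∀ x : ℝ, f x =
      if 1 ≤ |x| then Real.exp |x| else (Real.exp 1 / 2) * x ^ 2 + Real.exp 1 / 2) :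
    ContDiff ℝ 2 f ∧
    (∀ x : ℝ, 1 ≤ |x| → deriv (deriv f) x = Real.exp |x|) ∧
    (∀ x : ℝ, |x| < 1 → deriv (deriv f) x = Real.exp 1) ∧
    (¬ ∃ M : ℝ, ∀ x : ℝ, |deriv (deriv f) x| ≤ M) ∧
    (∀ ρ : ℝ, 1 ≤ ρ → ∀ x : ℝ, |deriv (deriv f) x| ≤ Real.exp 1 + |deriv f x| ^ ρ) := by
  have hd : ∀ x, HasDerivAt f (expAbsDeriv x) x := by
    refine hasDerivAt_of_eqOn_Iic_Icc_Ici (a := -1) (b := 1) (u := fun y => Real.exp (-y))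
      (v := fun y => Real.exp 1 / 2 * y ^ 2 + Real.exp 1 / 2) (w := Real.exp) ?_ ?_ ?_ ?_ ?_ ?_
    · intro y (hy : y ≤ -1)
      have h : |y| = -y := abs_of_nonpos (by linarith)
      rw [hf, h, if_pos (by linarith)]
    · intro y hy
      rcases (abs_le.2 hy).eq_or_lt with h | h
      · have h2 : y ^ 2 = 1 := by rw [← sq_abs, h, one_pow]
        simp only [hf, h, h2, le_refl, if_true]
        ring
      · rw [hf, if_neg h.not_ge]
    · intro y (hy : 1 ≤ y)
      have h : |y| = y := abs_of_nonneg (by linarith)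
      rw [hf, h, if_pos hy]
    · intro y hy
      rw [expAbsDeriv_of_le_neg_one hy]
      exact hasDerivAt_exp_neg y
    · intro y hy
      rw [expAbsDeriv_of_mem_Icc hy]
      have h : Real.exp 1 / 2 * (((2 : ℕ) : ℝ) * y ^ (2 - 1)) = Real.exp 1 * y := by
        norm_num
        ring
      rw [← h]
      exact ((hasDerivAt_pow 2 y).const_mul (Real.exp 1 / 2)).add_const (Real.exp 1 / 2)
    · intro y hy
      rw [expAbsDeriv_of_one_le hy]
      exact Real.hasDerivAt_exp y
  have hd1 : deriv f = expAbsDeriv := funext fun x => (hd x).deriv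
  have hd2 : deriv expAbsDeriv = fun x => Real.exp (max |x| 1) :=
    funext fun x => (hasDerivAt_expAbsDeriv x).deriv
  rw [hd1, hd2]
  refine ⟨?_, fun x hx => by simp only [max_eq_left hx],
    fun x hx => by simp only [max_eq_right hx.le], ?_, ?_⟩
  · rw [show (2 : WithTop ℕ∞) = 1 + 1 by norm_num, contDiff_succ_iff_deriv, hd1,
      contDiff_one_iff_deriv, hd2]
    exact ⟨fun x => (hd x).differentiableAt, by simp,
      fun x => (hasDerivAt_expAbsDeriv x).differentiableAt, by fun_prop⟩
  · rintro ⟨M, hM⟩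
    have h := hM M
    rw [Real.abs_exp] at h
    linarith [Real.add_one_le_exp (max |M| 1), le_max_left |M| 1, le_abs_self M]
  · intro ρ hρ x
    rw [Real.abs_exp]
    rcases le_total 1 |x| with hx | hx
    · rw [max_eq_left hx, abs_expAbsDeriv hx]
      have h := Real.self_le_rpow_of_one_le (Real.one_le_exp (abs_nonneg x)) hρ
      linarith [Real.exp_pos 1]
    · rw [max_eq_right hx]
      linarith [Real.rpow_nonneg (abs_nonneg (expAbsDeriv x)) ρ]
end

section
/- Let ρ ∈ (0,1) and define f : ℝ → ℝ by f(x) = ((1−ρ)/(2−ρ))|x|^{(2−ρ)/(1−ρ)} for |x| ≥ 1 and f(x) = (ρ/(8(1−ρ)))x⁴ + ((2−3ρ)/(4(1−ρ)))x² + (1−ρ)/(2−ρ) − (4−5ρ)/(8(1−ρ)) for |x| < 1. Then f is twice continuously differentiable, its second derivative f″(x) = (1/(1−ρ))|x|^{ρ/(1−ρ)} for |x| ≥ 1 is unbounded on ℝ, and the inequality |f″(x)| ≤ 1/(1−ρ) + (1/(1−ρ))|f′(x)|^ρ holds for all x ∈ ℝ. -/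
/-- Two functions that agree to first order on `|x| = 1` glue to a differentiable function. -/
lemma hasDerivAt_ite_one_le_abs {g h g' h' : ℝ → ℝ}
    (hg : ∀ x, 1 ≤ |x| → HasDerivAt g (g' x) x) (hh : ∀ x, |x| ≤ 1 → HasDerivAt h (h' x) x)
    (hgh : ∀ x, |x| = 1 → g x = h x) (hgh' : ∀ x, |x| = 1 → g' x = h' x) (x : ℝ) :
    HasDerivAt (fun y => if 1 ≤ |y| then g y else h y) (if 1 ≤ |x| then g' x else h' x) x := by
  rcases lt_trichotomy |x| 1 with hx | hx | hx
  · rw [if_neg hx.not_ge]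
    refine (hh x hx.le).congr_of_eventuallyEq ?_
    filter_upwards [(isOpen_lt continuous_abs continuous_const).mem_nhds hx] with y hy
    exact if_neg (not_le.mpr hy)
  · rw [if_pos hx.ge, ← hasDerivWithinAt_univ]
    have hU : {y : ℝ | 1 ≤ |y|} ∪ {y : ℝ | |y| ≤ 1} = Set.univ :=
      Set.eq_univ_of_forall fun y => le_total 1 |y|
    rw [← hU]
    refine HasDerivWithinAt.union ?_ ?_
    · exact (hg x hx.ge).hasDerivWithinAt.congr (fun y hy => if_pos hy) (if_pos hx.ge)
    · rw [hgh' x hx]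
      have heq : ∀ y : ℝ, |y| ≤ 1 → (if 1 ≤ |y| then g y else h y) = h y := by
        intro y hy
        split_ifs with hy'
        · exact hgh y (le_antisymm hy hy')
        · rfl
      exact (hh x hx.le).hasDerivWithinAt.congr heq (heq x hx.le)
  · rw [if_pos hx.le]
    refine (hg x hx.le).congr_of_eventuallyEq ?_
    filter_upwards [(isOpen_lt continuous_const continuous_abs).mem_nhds hx] with y hy
    exact if_pos (le_of_lt hy)

lemma hasDerivAt_abs_rpow_mul_self (a : ℝ) {x : ℝ} (hx : x ≠ 0) :
    HasDerivAt (fun y : ℝ => |y| ^ a * y) ((a + 1) * |x| ^ a) x := by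
  have hx' : |x| ≠ 0 := abs_ne_zero.mpr hx
  refine (((hasDerivAt_abs hx).rpow_const (p := a) (Or.inl hx')).mul
    (hasDerivAt_id x)).congr_deriv ?_
  rw [Real.rpow_sub_one hx']
  have h : (SignType.sign x : ℝ) * x = |x| := sign_mul_self x
  simp only [id]
  field_simp
  linear_combination a * h


/-- For `ρ ∈ (0,1)`, the function
`f(x) = ((1−ρ)/(2−ρ))|x|^{(2−ρ)/(1−ρ)}` for `|x| ≥ 1` and
`f(x) = (ρ/(8(1−ρ)))x⁴ + ((2−3ρ)/(4(1−ρ)))x² + (1−ρ)/(2−ρ) − (4−5ρ)/(8(1−ρ))` for `|x| < 1`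
is twice continuously differentiable, its second derivative equals
`(1/(1−ρ))|x|^{ρ/(1−ρ)}` for `|x| ≥ 1` and is unbounded on `ℝ`, and
`|f''(x)| ≤ 1/(1−ρ) + (1/(1−ρ))|f'(x)|^ρ` holds for all `x`. -/
theorem chen_example (ρ : ℝ) (hρ0 : 0 < ρ) (hρ1 : ρ < 1) (f : ℝ → ℝ)
    (hf : ∀ x : ℝ, f x =
      if 1 ≤ |x| then ((1 - ρ) / (2 - ρ)) * |x| ^ ((2 - ρ) / (1 - ρ))
      else (ρ / (8 * (1 - ρ))) * x ^ 4 + ((2 - 3 * ρ) / (4 * (1 - ρ))) * x ^ 2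
        + (1 - ρ) / (2 - ρ) - (4 - 5 * ρ) / (8 * (1 - ρ))) :
    ContDiff ℝ 2 f ∧
    (∀ x : ℝ, 1 ≤ |x| → deriv (deriv f) x = (1 / (1 - ρ)) * |x| ^ (ρ / (1 - ρ))) ∧
    (¬ ∃ M : ℝ, ∀ x : ℝ, |deriv (deriv f) x| ≤ M) ∧
    (∀ x : ℝ, |deriv (deriv f) x| ≤ 1 / (1 - ρ) + (1 / (1 - ρ)) * |deriv f x| ^ ρ) := by
  have h1 : 0 < 1 - ρ := sub_pos.mpr hρ1
  have h2 : 0 < 2 - ρ := by linarith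
  have ha : 0 < ρ / (1 - ρ) := div_pos hρ0 h1
  have hsq : ∀ x : ℝ, |x| = 1 → x ^ 2 = 1 := fun x hx => by rw [← sq_abs, hx, one_pow]
  have hd1 : ∀ x, HasDerivAt f (if 1 ≤ |x| then |x| ^ (ρ / (1 - ρ)) * x else
      (ρ / (2 * (1 - ρ))) * x ^ 3 + ((2 - 3 * ρ) / (2 * (1 - ρ))) * x) x := by
    rw [funext hf]
    refine hasDerivAt_ite_one_le_abs (fun x _ => ?_) (fun x _ => ?_) (fun x hx => ?_)
      (fun x hx => ?_)
    · have hp : 1 < (2 - ρ) / (1 - ρ) := by rw [one_lt_div h1]; linarith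
      refine ((hasDerivAt_abs_rpow x hp).const_mul ((1 - ρ) / (2 - ρ))).congr_deriv ?_
      rw [show (2 - ρ) / (1 - ρ) - 2 = ρ / (1 - ρ) by field_simp; ring]
      field_simp
    · refine (((((hasDerivAt_pow 4 x).const_mul (ρ / (8 * (1 - ρ)))).add
        ((hasDerivAt_pow 2 x).const_mul ((2 - 3 * ρ) / (4 * (1 - ρ))))).add_const
        ((1 - ρ) / (2 - ρ))).sub_const ((4 - 5 * ρ) / (8 * (1 - ρ)))).congr_deriv ?_
      field_simp
      ring
    · rw [hx, Real.one_rpow, show x ^ 4 = (x ^ 2) ^ 2 by ring, hsq x hx]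
      field_simp
      ring
    · rw [hx, Real.one_rpow, show x ^ 3 = x ^ 2 * x by ring, hsq x hx]
      field_simp
      ring
  have hd2 : ∀ x, HasDerivAt (deriv f) (if 1 ≤ |x| then (1 / (1 - ρ)) * |x| ^ (ρ / (1 - ρ)) else
      (3 * ρ / (2 * (1 - ρ))) * x ^ 2 + (2 - 3 * ρ) / (2 * (1 - ρ))) x := by
    rw [funext fun x => (hd1 x).deriv]
    refine hasDerivAt_ite_one_le_abs (fun x hx => ?_) (fun x _ => ?_) (fun x hx => ?_)
      (fun x hx => ?_)
    · refine (hasDerivAt_abs_rpow_mul_self (ρ / (1 - ρ))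
        (abs_pos.mp (zero_lt_one.trans_le hx))).congr_deriv ?_
      field_simp
      ring
    · refine (((hasDerivAt_pow 3 x).const_mul (ρ / (2 * (1 - ρ)))).add
        ((hasDerivAt_id x).const_mul ((2 - 3 * ρ) / (2 * (1 - ρ))))).congr_deriv ?_
      field_simp
      ring
    · rw [hx, Real.one_rpow, show x ^ 3 = x ^ 2 * x by ring, hsq x hx]
      field_simp
      ring
    · rw [hx, Real.one_rpow, hsq x hx]
      field_simp
      ring
  have hout : ∀ x : ℝ, 1 ≤ |x| → deriv (deriv f) x = (1 / (1 - ρ)) * |x| ^ (ρ / (1 - ρ)) :=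
    fun x hx => by rw [(hd2 x).deriv, if_pos hx]
  refine ⟨?_, hout, ?_, fun x => ?_⟩
  · rw [show (2 : WithTop ℕ∞) = 1 + 1 by norm_num, contDiff_succ_iff_deriv]
    refine ⟨fun x => (hd1 x).differentiableAt, by simp, ?_⟩
    rw [contDiff_one_iff_deriv]
    refine ⟨fun x => (hd2 x).differentiableAt, ?_⟩
    rw [funext fun x => (hd2 x).deriv]
    refine Continuous.if_le (continuous_const.mul (continuous_abs.rpow_const fun _ => .inr ha.le))
      (by fun_prop) continuous_const continuous_abs fun x hx => ?_
    rw [← hx, Real.one_rpow, hsq x hx.symm]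
    field_simp
    ring
  · rintro ⟨M, hM⟩
    have ht : Filter.Tendsto (fun x : ℝ => (1 / (1 - ρ)) * x ^ (ρ / (1 - ρ))) .atTop .atTop :=
      (tendsto_rpow_atTop ha).const_mul_atTop (one_div_pos.mpr h1)
    obtain ⟨x, hx, hx1⟩ :=
      ((ht.eventually_gt_atTop M).and (Filter.eventually_ge_atTop 1)).exists
    have hxa : |x| = x := abs_of_nonneg (zero_le_one.trans hx1)
    have hle := (le_abs_self _).trans (hM x)
    rw [hout x (hxa.symm ▸ hx1), hxa] at hle
    exact hle.not_gt hx
  · by_cases hx : 1 ≤ |x|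
    · have hx0 : 0 < |x| := zero_lt_one.trans_le hx
      have hf' : |deriv f x| ^ ρ = |x| ^ (ρ / (1 - ρ)) := by
        rw [(hd1 x).deriv, if_pos hx, abs_mul, abs_of_nonneg (Real.rpow_nonneg hx0.le _),
          ← Real.rpow_add_one hx0.ne', ← Real.rpow_mul hx0.le]
        congr 1
        field_simp
        ring
      rw [hout x hx, hf', abs_of_nonneg (by positivity)]
      exact le_add_of_nonneg_left (by positivity)
    · have hx2 : x ^ 2 ≤ 1 := by rw [← sq_abs]; exact pow_le_one₀ (abs_nonneg x) (not_le.mp hx).le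
      refine le_add_of_le_of_nonneg ?_ (by positivity)
      rw [(hd2 x).deriv, if_neg hx, show 3 * ρ / (2 * (1 - ρ)) * x ^ 2 + (2 - 3 * ρ) / (2 * (1 - ρ))
        = (3 * ρ * x ^ 2 + 2 - 3 * ρ) / 2 / (1 - ρ) by field_simp; ring, abs_div, abs_of_pos h1]
      gcongr
      rw [abs_le]
      constructor <;> nlinarith [mul_nonneg hρ0.le (sq_nonneg x)]
end

section
/- Let f : ℝ^p → ℝ be twice continuously differentiable and let ρ ≥ 0. Suppose there exist a sequence of points {xⁿ} ⊂ ℝ^p and a sequence of nonnegative reals {κₙ} such that: (1) κₙ → ∞; (2) liminfₙ κₙ‖∇f(xⁿ)‖₂^ρ = ∞; and (3) ‖∇²f(xⁿ)‖₂ ≥ κₙ‖∇f(xⁿ)‖₂^ρ for all n, where ‖∇²f(xⁿ)‖₂ is the spectral norm of the Hessian. Then ∇f is not ρ-order Lipschitz continuous for any constants C₀, C₁ ≥ 0. -/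
open Metric Filter

/-- Let `f : ℝ^p → ℝ` be twice continuously differentiable and `ρ ≥ 0`.
If there are points `xⁿ` and nonnegative reals `κₙ` with `κₙ → ∞`,
`liminfₙ κₙ‖∇f(xⁿ)‖^ρ = ∞` (i.e. `κₙ‖∇f(xⁿ)‖^ρ → ∞`), and
`‖∇²f(xⁿ)‖ ≥ κₙ‖∇f(xⁿ)‖^ρ` for all `n` (spectral norm of the Hessian), then `∇f` is not
`ρ`-order Lipschitz continuous for any constants `C₀, C₁ ≥ 0`. -/
theorem not_rho_order_of_diverging_sequence
    (p : ℕ) (f : EuclideanSpace ℝ (Fin p) → ℝ) (hf : ContDiff ℝ 2 f)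
    (ρ : ℝ) (hρ : 0 ≤ ρ)
    (x : ℕ → EuclideanSpace ℝ (Fin p)) (κ : ℕ → ℝ) (hκ : ∀ n, 0 ≤ κ n)
    (h1 : Tendsto κ atTop atTop)
    (h2 : Tendsto (fun n => κ n * ‖gradient f (x n)‖ ^ ρ) atTop atTop)
    (h3 : ∀ n, κ n * ‖gradient f (x n)‖ ^ ρ ≤ ‖fderiv ℝ (gradient f) (x n)‖) :
    ∀ C₀ C₁ : ℝ, 0 ≤ C₀ → 0 ≤ C₁ →
      ¬ (∀ y : EuclideanSpace ℝ (Fin p), ∃ r > 0, ∀ x₁ ∈ ball y r, ∀ x₂ ∈ ball y r,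
        ‖gradient f x₁ - gradient f x₂‖ ≤
          (C₀ + C₁ * ‖gradient f y‖ ^ ρ) * ‖x₁ - x₂‖) := by
  intro C₀ C₁ hC₀ hC₁ hlip
  obtain ⟨n, hκn, hgn⟩ :=
    ((h1.eventually_ge_atTop (2 * C₁)).and (h2.eventually_gt_atTop (2 * C₀))).exists
  obtain ⟨r, hr, hball⟩ := hlip (x n)
  have hg : 0 ≤ ‖gradient f (x n)‖ ^ ρ := by positivity
  have hle : ‖fderiv ℝ (gradient f) (x n)‖ ≤ C₀ + C₁ * ‖gradient f (x n)‖ ^ ρ := by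
    refine norm_fderiv_le_of_lip' ℝ (by positivity) ?_
    filter_upwards [ball_mem_nhds (x n) hr] with y hy
    exact hball y hy (x n) (mem_ball_self hr)
  nlinarith [h3 n, mul_le_mul_of_nonneg_right hκn hg]
end

section
/- Let f : ℝ⁴ → ℝ be defined by f(x) = log(1 + exp(−x₁x₂x₃x₄)). Then for every ρ ≥ 0, the gradient ∇f : ℝ⁴ → ℝ⁴ is neither ρ-order Lipschitz continuous nor ρ-integrated Lipschitz continuous (for any choice of constants C₀, C₁ ≥ 0). -/
open Metric

/-- At a point with vanishing last coordinate, the gradient of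
`x ↦ log (1 + exp (-(x 0 * x 1 * x 2 * x 3)))` only has a component along the last axis. -/
theorem gradient_log_one_add_exp_neg_prod
    (f : EuclideanSpace ℝ (Fin 4) → ℝ)
    (hf : ∀ x : EuclideanSpace ℝ (Fin 4),
      f x = Real.log (1 + Real.exp (-(x 0 * x 1 * x 2 * x 3))))
    (x : EuclideanSpace ℝ (Fin 4)) (hx : x 3 = 0) :
    gradient f x = EuclideanSpace.single 3 (-(x 0 * x 1 * x 2) / 2) := by
  apply HasGradientAt.gradient
  rw [hasGradientAt_iff_hasFDerivAt]
  have hproj (i : Fin 4) : HasFDerivAt (fun y : EuclideanSpace ℝ (Fin 4) => y i)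
      (EuclideanSpace.proj i : EuclideanSpace ℝ (Fin 4) →L[ℝ] ℝ) x :=
    (EuclideanSpace.proj i : EuclideanSpace ℝ (Fin 4) →L[ℝ] ℝ).hasFDerivAt
  have hlog := (((((hproj 0).mul (hproj 1)).mul (hproj 2)).mul (hproj 3)).neg.exp.const_add
    1).log (by positivity)
  rw [show f = _ from funext hf]
  refine hlog.congr_fderiv ?_
  ext v
  simp [hx, EuclideanSpace.inner_single_left]
  ring

/-- On the points `(K, 1, s, 0)` the gradient of `x ↦ log (1 + exp (-(x 0 * x 1 * x 2 * x 3)))`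
is linear in `s` with slope of order `K`. -/
theorem gradient_log_one_add_exp_neg_prod_line
    (f : EuclideanSpace ℝ (Fin 4) → ℝ)
    (hf : ∀ x : EuclideanSpace ℝ (Fin 4),
      f x = Real.log (1 + Real.exp (-(x 0 * x 1 * x 2 * x 3))))
    (K s : ℝ) :
    gradient f !₂[K, 1, s, 0] = EuclideanSpace.single 3 (-(K * s) / 2) := by
  rw [gradient_log_one_add_exp_neg_prod f hf _ (by simp)]
  simp

/-- For `f(x) = log(1 + exp(−x₁x₂x₃x₄))` on `ℝ⁴` and every `ρ ≥ 0`, the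
gradient `∇f` is neither `ρ`-order Lipschitz continuous nor `ρ`-integrated Lipschitz
continuous, for any choice of constants `C₀, C₁ ≥ 0`. -/
theorem three_layer_grad_not_rho_lipschitz
    (f : EuclideanSpace ℝ (Fin 4) → ℝ)
    (hf : ∀ x : EuclideanSpace ℝ (Fin 4),
      f x = Real.log (1 + Real.exp (-(x 0 * x 1 * x 2 * x 3))))
    (ρ : ℝ) (hρ : 0 ≤ ρ) :
    (∀ C₀ C₁ : ℝ, 0 ≤ C₀ → 0 ≤ C₁ →
      ¬ (∀ x : EuclideanSpace ℝ (Fin 4), ∃ r > 0, ∀ x₁ ∈ ball x r, ∀ x₂ ∈ ball x r,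
        ‖gradient f x₁ - gradient f x₂‖ ≤
          (C₀ + C₁ * ‖gradient f x‖ ^ ρ) * ‖x₁ - x₂‖)) ∧
    (∀ C₀ C₁ : ℝ, 0 ≤ C₀ → 0 ≤ C₁ →
      ¬ (∀ x₁ x₂ : EuclideanSpace ℝ (Fin 4),
        ‖gradient f x₁ - gradient f x₂‖ ≤
          (C₀ + C₁ * ∫ t in (0:ℝ)..1, ‖gradient f (x₁ + t • (x₂ - x₁))‖ ^ ρ) *
            ‖x₁ - x₂‖)) := by
  have hline (K s : ℝ) : (!₂[K, 1, 0, 0] : EuclideanSpace ℝ (Fin 4)) - !₂[K, 1, s, 0] =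
      EuclideanSpace.single 2 (-s) := by
    ext i; fin_cases i <;> simp
  have hgrad := gradient_log_one_add_exp_neg_prod_line f hf
  have hdiff (K s : ℝ) (hK : 0 < K) (hs : 0 < s) :
      ‖gradient f !₂[K, 1, 0, 0] - gradient f !₂[K, 1, s, 0]‖ = K * s / 2 := by
    rw [hgrad, hgrad, ← dist_eq_norm, PiLp.dist_single_same, Real.dist_eq,
      abs_of_nonneg (by linarith [mul_pos hK hs])]
    ring
  have hdist (K s : ℝ) (hs : 0 < s) :
      ‖(!₂[K, 1, 0, 0] : EuclideanSpace ℝ (Fin 4)) - !₂[K, 1, s, 0]‖ = s := by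
    rw [hline]
    simp [abs_of_pos hs]
  constructor
  · intro C₀ C₁ h₀ h₁ h
    set K : ℝ := 2 * (C₀ + C₁) + 1 with hKdef
    have hK : 0 < K := by positivity
    obtain ⟨r, hr, hball⟩ := h !₂[K, 1, 0, 0]
    have hr₂ : 0 < r / 2 := half_pos hr
    have hmem : !₂[K, 1, r / 2, 0] ∈ ball (!₂[K, 1, 0, 0] : EuclideanSpace ℝ (Fin 4)) r := by
      rw [mem_ball', dist_eq_norm, hdist K _ hr₂]
      exact half_lt_self hr
    have hle := hball _ (mem_ball_self hr) _ hmem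
    have hpow : ‖gradient f !₂[K, 1, 0, 0]‖ ^ ρ ≤ 1 :=
      Real.rpow_le_one (norm_nonneg _) (by simp [hgrad]) hρ
    rw [hdiff K _ hK hr₂, hdist K _ hr₂] at hle
    nlinarith [mul_le_mul_of_nonneg_right (mul_le_mul_of_nonneg_left hpow h₁) hr₂.le]
  · intro C₀ C₁ h₀ h₁ h
    set K : ℝ := 2 * (C₀ + C₁) + 1 with hKdef
    have hK : 0 < K := by positivity
    have hs : 0 < K⁻¹ := inv_pos.2 hK
    have hle := h !₂[K, 1, 0, 0] !₂[K, 1, K⁻¹, 0]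
    have hint : ∫ t in (0 : ℝ)..1, ‖gradient f ((!₂[K, 1, 0, 0] : EuclideanSpace ℝ (Fin 4)) +
        t • (!₂[K, 1, K⁻¹, 0] - !₂[K, 1, 0, 0]))‖ ^ ρ ≤ 1 := by
      refine (Real.le_norm_self _).trans ((intervalIntegral.norm_integral_le_of_norm_le_const
        (C := 1) fun t ht => ?_).trans_eq (by simp))
      rw [Set.uIoc_of_le zero_le_one] at ht
      have hpt : (!₂[K, 1, 0, 0] : EuclideanSpace ℝ (Fin 4)) +
          t • (!₂[K, 1, K⁻¹, 0] - !₂[K, 1, 0, 0]) = !₂[K, 1, t * K⁻¹, 0] := by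
        ext i; fin_cases i <;> simp
      rw [Real.norm_of_nonneg (by positivity), hpt, hgrad]
      refine Real.rpow_le_one (norm_nonneg _) ?_ hρ
      rw [mul_left_comm, mul_inv_cancel₀ hK.ne', PiLp.norm_single, Real.norm_eq_abs, abs_le]
      constructor <;> linarith [ht.1, ht.2]
    rw [hdiff K _ hK hs, hdist K _ hs] at hle
    nlinarith [mul_le_mul_of_nonneg_right (mul_le_mul_of_nonneg_left hint h₁) hs.le]
end

section
/- Let f : ℝ⁴ → ℝ be defined by f(x) = log(1 + exp(−x₁x₂x₃x₄)), and for an integer n ≥ 2 let xⁿ = (1/n, 1, 1, n·log n). Then the Euclidean norm of the gradient satisfies ‖∇f(xⁿ)‖₂ = √(n^{−2} + 2(log n)² + n²(log n)²)/(1 + n), and moreover (1/2)log n ≤ ‖∇f(xⁿ)‖₂ ≤ 2 log n. -/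
/-- The gradient of `x ↦ log (1 + exp (-(x₀ x₁ x₂ x₃)))` on `ℝ⁴`. -/
theorem hasGradientAt_log_one_add_exp_neg_prod (x : EuclideanSpace ℝ (Fin 4)) :
    HasGradientAt
      (fun y : EuclideanSpace ℝ (Fin 4) => Real.log (1 + Real.exp (-(y 0 * y 1 * y 2 * y 3))))
      ((-(1 / (1 + Real.exp (x 0 * x 1 * x 2 * x 3)))) •
        !₂[x 1 * x 2 * x 3, x 0 * x 2 * x 3, x 0 * x 1 * x 3, x 0 * x 1 * x 2]) x := by
  have hproj (i : Fin 4) : HasFDerivAt (fun y : EuclideanSpace ℝ (Fin 4) => y i)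
      (EuclideanSpace.proj i : EuclideanSpace ℝ (Fin 4) →L[ℝ] ℝ) x :=
    (EuclideanSpace.proj i : EuclideanSpace ℝ (Fin 4) →L[ℝ] ℝ).hasFDerivAt
  have hpos : 0 < 1 + Real.exp (-(x 0 * x 1 * x 2 * x 3)) := by positivity
  have hderiv := (((((hproj 0).mul (hproj 1)).mul (hproj 2)).mul (hproj 3)).neg.exp.const_add
    1).log hpos.ne'
  have hcoeff : (1 + Real.exp (-(x 0 * x 1 * x 2 * x 3)))⁻¹ * Real.exp (-(x 0 * x 1 * x 2 * x 3)) =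
      1 / (1 + Real.exp (x 0 * x 1 * x 2 * x 3)) := by
    rw [Real.exp_neg]
    have := Real.exp_pos (x 0 * x 1 * x 2 * x 3)
    field_simp
    ring
  rw [hasGradientAt_iff_hasFDerivAt]
  refine hderiv.congr_fderiv ?_
  ext v
  simp only [Pi.mul_apply, Pi.neg_apply, smul_smul, hcoeff]
  simp [PiLp.inner_apply, Fin.sum_univ_four]
  ring


/-- For `f(x) = log(1 + exp(−x₁x₂x₃x₄))` on `ℝ⁴` and
`xⁿ = (1/n, 1, 1, n·log n)` with `n ≥ 2`, the Euclidean norm of the gradient equals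
`√(n⁻² + 2(log n)² + n²(log n)²)/(1 + n)`, and `(1/2)log n ≤ ‖∇f(xⁿ)‖ ≤ 2 log n`. -/
theorem three_layer_grad_norm_at_sequence
    (f : EuclideanSpace ℝ (Fin 4) → ℝ)
    (hf : ∀ x : EuclideanSpace ℝ (Fin 4),
      f x = Real.log (1 + Real.exp (-(x 0 * x 1 * x 2 * x 3))))
    (n : ℕ) (hn : 2 ≤ n) (x : EuclideanSpace ℝ (Fin 4))
    (hx0 : x 0 = (n : ℝ)⁻¹) (hx1 : x 1 = 1) (hx2 : x 2 = 1)
    (hx3 : x 3 = (n : ℝ) * Real.log n) :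
    ‖gradient f x‖ =
      Real.sqrt (((n : ℝ) ^ 2)⁻¹ + 2 * Real.log n ^ 2 + (n : ℝ) ^ 2 * Real.log n ^ 2) /
        (1 + (n : ℝ)) ∧
    (1 / 2) * Real.log n ≤ ‖gradient f x‖ ∧
    ‖gradient f x‖ ≤ 2 * Real.log n := by
  have hn' : (2 : ℝ) ≤ n := by exact_mod_cast hn
  have hn0 : (0 : ℝ) < n := by linarith
  have hlog : (1 / 2 : ℝ) ≤ Real.log n := by
    have := Real.log_le_log (by norm_num) hn'
    linarith [Real.log_two_gt_d9]
  have hnorm : ‖gradient f x‖ =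
      Real.sqrt (((n : ℝ) ^ 2)⁻¹ + 2 * Real.log n ^ 2 + (n : ℝ) ^ 2 * Real.log n ^ 2) /
        (1 + (n : ℝ)) := by
    have hprod : (n : ℝ)⁻¹ * (n * Real.log n) = Real.log n := by field_simp
    rw [funext hf, (hasGradientAt_log_one_add_exp_neg_prod x).gradient, norm_smul,
      EuclideanSpace.norm_eq, hx0, hx1, hx2, hx3]
    simp only [mul_one, one_mul, hprod, Real.exp_log hn0, norm_neg, Real.norm_eq_abs, sq_abs,
      Fin.sum_univ_four]
    rw [abs_of_pos (by positivity), one_div_mul_eq_div]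
    congr 2
    simp
    ring
  refine ⟨hnorm, ?_, ?_⟩
  · rw [hnorm, le_div_iff₀ (by positivity)]
    apply Real.le_sqrt_of_sq_le
    have hle : 1 / 2 * Real.log n * (1 + n) ≤ n * Real.log n := by nlinarith
    have hsq := pow_le_pow_left₀ (by positivity) hle 2
    have : 0 ≤ ((n : ℝ) ^ 2)⁻¹ := by positivity
    nlinarith [sq_nonneg (Real.log n)]
  · rw [hnorm, div_le_iff₀ (by positivity)]
    apply Real.sqrt_le_iff.mpr ⟨by positivity, ?_⟩
    have hinv : ((n : ℝ) ^ 2)⁻¹ ≤ 1 / 4 := by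
      rw [inv_le_comm₀ (by positivity) (by norm_num)]
      nlinarith
    have hsq : (1 / 4 : ℝ) ≤ Real.log n ^ 2 := by nlinarith
    have : 0 ≤ (n : ℝ) * Real.log n ^ 2 := by positivity
    have : 0 ≤ (n : ℝ) ^ 2 * Real.log n ^ 2 := by positivity
    nlinarith
end

section
/- Let f : ℝ⁴ → ℝ be defined by f(x) = log(1 + exp(−x₁x₂x₃x₄)), and for an integer n ≥ 1 let xⁿ = (1/n, 1, 1, n·log n). Then the (1,1) entry of the Hessian satisfies ∂²f/∂x₁²(xⁿ) = (n/(1+n)²)·n²(log n)² ≥ n(log n)²/4. -/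
/-- A directional Fréchet derivative along the first coordinate is computed on the line. -/
lemma fderiv_single_zero_eq_of_hasDerivAt {g : EuclideanSpace ℝ (Fin 4) → ℝ}
    {y : EuclideanSpace ℝ (Fin 4)} {d : ℝ} (hg : DifferentiableAt ℝ g y)
    (hd : HasDerivAt (fun t : ℝ => g (y + t • EuclideanSpace.single 0 1)) d 0) :
    fderiv ℝ g y (EuclideanSpace.single 0 1) = d := by
  rw [← hg.lineDeriv_eq_fderiv]
  exact hd.deriv

lemma hasDerivAt_log_one_add_exp_neg_mul (a c : ℝ) :
    HasDerivAt (fun t : ℝ => Real.log (1 + Real.exp (-((a + t) * c))))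
      (-c / (1 + Real.exp (a * c))) 0 := by
  have hlin : HasDerivAt (fun t : ℝ => -((a + t) * c)) (-c) 0 := by
    simpa using (((hasDerivAt_id (0 : ℝ)).const_add a).mul_const c).fun_neg
  refine ((hlin.exp.const_add 1).log (by positivity)).congr_deriv ?_
  rw [add_zero, Real.exp_neg]
  field_simp
  ring

lemma hasDerivAt_neg_div_one_add_exp_mul (a c : ℝ) :
    HasDerivAt (fun t : ℝ => -c / (1 + Real.exp ((a + t) * c)))
      (Real.exp (a * c) / (1 + Real.exp (a * c)) ^ 2 * c ^ 2) 0 := by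
  have hlin : HasDerivAt (fun t : ℝ => (a + t) * c) c 0 := by
    simpa using ((hasDerivAt_id (0 : ℝ)).const_add a).mul_const c
  refine ((hasDerivAt_const (0 : ℝ) (-c)).fun_div (hlin.exp.const_add 1)
    (by positivity)).congr_deriv ?_
  rw [add_zero]
  ring

/-- The first partial derivative of the logistic loss of a product of four variables. -/
lemma fderiv_logistic_prod_single_zero (y : EuclideanSpace ℝ (Fin 4)) :
    fderiv ℝ (fun x : EuclideanSpace ℝ (Fin 4) =>
        Real.log (1 + Real.exp (-(x 0 * x 1 * x 2 * x 3)))) y (EuclideanSpace.single 0 1) =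
      -(y 1 * y 2 * y 3) / (1 + Real.exp (y 0 * (y 1 * y 2 * y 3))) := by
  apply fderiv_single_zero_eq_of_hasDerivAt
  · exact DifferentiableAt.log (by fun_prop) (by positivity)
  · simpa [mul_assoc] using hasDerivAt_log_one_add_exp_neg_mul (y 0) (y 1 * y 2 * y 3)

/-- The `(1,1)` Hessian entry of the logistic loss of a product of four variables. -/
lemma fderiv_fderiv_logistic_prod_single_zero (y : EuclideanSpace ℝ (Fin 4)) :
    fderiv ℝ (fun z => fderiv ℝ (fun x : EuclideanSpace ℝ (Fin 4) =>
        Real.log (1 + Real.exp (-(x 0 * x 1 * x 2 * x 3)))) z (EuclideanSpace.single 0 1)) y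
        (EuclideanSpace.single 0 1) =
      Real.exp (y 0 * (y 1 * y 2 * y 3)) / (1 + Real.exp (y 0 * (y 1 * y 2 * y 3))) ^ 2 *
        (y 1 * y 2 * y 3) ^ 2 := by
  simp_rw [fderiv_logistic_prod_single_zero]
  apply fderiv_single_zero_eq_of_hasDerivAt
  · have hden : 1 + Real.exp (y 0 * (y 1 * y 2 * y 3)) ≠ 0 := by positivity
    fun_prop (disch := exact hden)
  · simpa using hasDerivAt_neg_div_one_add_exp_mul (y 0) (y 1 * y 2 * y 3)

/-- For `f(x) = log(1 + exp(−x₁x₂x₃x₄))` on `ℝ⁴` and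
`xⁿ = (1/n, 1, 1, n·log n)` with `n ≥ 1`, the `(1,1)` entry of the Hessian (the second
partial derivative of `f` in the first coordinate direction) equals
`(n/(1+n)²)·n²(log n)²`, which is at least `n(log n)²/4`. -/
theorem three_layer_hessian_entry_at_sequence
    (f : EuclideanSpace ℝ (Fin 4) → ℝ)
    (hf : ∀ x : EuclideanSpace ℝ (Fin 4),
      f x = Real.log (1 + Real.exp (-(x 0 * x 1 * x 2 * x 3))))
    (n : ℕ) (hn : 1 ≤ n) (x : EuclideanSpace ℝ (Fin 4))
    (hx0 : x 0 = (n : ℝ)⁻¹) (hx1 : x 1 = 1) (hx2 : x 2 = 1)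
    (hx3 : x 3 = (n : ℝ) * Real.log n) :
    fderiv ℝ (fun y : EuclideanSpace ℝ (Fin 4) =>
        fderiv ℝ f y (EuclideanSpace.single 0 1)) x (EuclideanSpace.single 0 1) =
      ((n : ℝ) / (1 + (n : ℝ)) ^ 2) * ((n : ℝ) ^ 2 * Real.log n ^ 2) ∧
    (n : ℝ) * Real.log n ^ 2 / 4 ≤
      ((n : ℝ) / (1 + (n : ℝ)) ^ 2) * ((n : ℝ) ^ 2 * Real.log n ^ 2) := by
  have hn_one : (1 : ℝ) ≤ n := by exact_mod_cast hn
  have hn_pos : (0 : ℝ) < n := by linarith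
  constructor
  · obtain rfl : f = _ := funext hf
    have hprod : (n : ℝ)⁻¹ * (1 * 1 * ((n : ℝ) * Real.log n)) = Real.log n := by
      field_simp
    rw [fderiv_fderiv_logistic_prod_single_zero, hx0, hx1, hx2, hx3, hprod,
      Real.exp_log hn_pos]
    ring
  · have hratio : (1 : ℝ) / 4 ≤ (n : ℝ) ^ 2 / (1 + (n : ℝ)) ^ 2 := by
      rw [div_le_div_iff₀ (by norm_num) (by positivity)]
      nlinarith
    calc (n : ℝ) * Real.log n ^ 2 / 4 = 1 / 4 * (n * Real.log n ^ 2) := by ring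
      _ ≤ (n : ℝ) ^ 2 / (1 + (n : ℝ)) ^ 2 * (n * Real.log n ^ 2) := by gcongr
      _ = _ := by ring
end

section
/- Let N ≥ 4 and d ≥ 1 be integers and let f be the deep linear network objective of the parameters (W₁, …, W_N, b₁, …, b_N) with W₁, …, W_{N−1} ∈ ℝ^{d×d}, W_N ∈ ℝ^{1×d}, b₁, …, b_{N−1} ∈ ℝ^d, b_N ∈ ℝ, defined by f = (1/2)[η_𝟎 + log(1 + exp(−η_𝟎))] + (1/2)log(1 + exp(−η_{s₁})), where for z ∈ ℝ^d, η_z = W_N(W_{N−1}(⋯(W₂(W₁z + b₁) + b₂)⋯) + b_{N−1}) + b_N and s₁ is the first standard basis vector of ℝ^d. Then for every ρ ≥ 0, the gradient ∇f is neither ρ-order Lipschitz continuous nor ρ-integrated Lipschitz continuous (for any constants C₀, C₁ ≥ 0). -/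
open Metric

noncomputable section

/-- Index type for the parameters `(W₁, …, W_N, b₁, …, b_N)` of the deep linear network:
`Sum.inl (i, k, r)` is the `(k,r)` entry of the hidden weight `W_{i+1} ∈ ℝ^{d×d}`
(`i : Fin (N−1)`), `Sum.inr (Sum.inl r)` is the `r`-th entry of the output weight
`W_N ∈ ℝ^{1×d}`, `Sum.inr (Sum.inr (Sum.inl (i, r)))` is the `r`-th entry of the hidden
bias `b_{i+1} ∈ ℝ^d`, and `Sum.inr (Sum.inr (Sum.inr ()))` is the output bias `b_N ∈ ℝ`. -/
abbrev ParamIdx (N d : ℕ) : Type :=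
  (Fin (N - 1) × Fin d × Fin d) ⊕ (Fin d ⊕ ((Fin (N - 1) × Fin d) ⊕ Unit))

/-- The parameter space, identified with a finite-dimensional Euclidean space. -/
abbrev ParamSpace (N d : ℕ) : Type := EuclideanSpace ℝ (ParamIdx N d)

/-- The hidden weight matrix `W_{i+1} ∈ ℝ^{d×d}` (for `i < N−1`) read off `θ`. -/
def Wmat {N d : ℕ} (θ : ParamSpace N d) (i : ℕ) : Matrix (Fin d) (Fin d) ℝ :=
  fun k r => if h : i < N - 1 then θ (Sum.inl (⟨i, h⟩, k, r)) else 0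

/-- The output weight `W_N ∈ ℝ^{1×d}`, as a vector, read off `θ`. -/
def WNrow {N d : ℕ} (θ : ParamSpace N d) : Fin d → ℝ :=
  fun r => θ (Sum.inr (Sum.inl r))

/-- The hidden bias `b_{i+1} ∈ ℝ^d` (for `i < N−1`) read off `θ`. -/
def bvec {N d : ℕ} (θ : ParamSpace N d) (i : ℕ) : Fin d → ℝ :=
  fun r => if h : i < N - 1 then θ (Sum.inr (Sum.inr (Sum.inl (⟨i, h⟩, r)))) else 0

/-- The output bias `b_N ∈ ℝ` read off `θ`. -/
def bLast {N d : ℕ} (θ : ParamSpace N d) : ℝ :=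
  θ (Sum.inr (Sum.inr (Sum.inr ())))

/-- The hidden-layer recursion: `layers θ z 0 = z` and
`layers θ z (m+1) = W_{m+1} (layers θ z m) + b_{m+1}`. -/
def layers {N d : ℕ} (θ : ParamSpace N d) (z : Fin d → ℝ) : ℕ → Fin d → ℝ
  | 0 => z
  | m + 1 => (Wmat θ m).mulVec (layers θ z m) + bvec θ m

/-- The argument `η_z` of the sigmoid output layer:
`η_z = W_N(W_{N−1}(⋯(W₁z + b₁)⋯) + b_{N−1}) + b_N`. -/
def eta {N d : ℕ} (θ : ParamSpace N d) (z : Fin d → ℝ) : ℝ :=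
  (∑ r, WNrow θ r * layers θ z (N - 1) r) + bLast θ

/-- The first standard basis vector `s₁` of `ℝ^d`. -/
def stdBasisOne (d : ℕ) : Fin d → ℝ := fun j => if (j : ℕ) = 0 then 1 else 0

/-- The deep linear network objective
`f = (1/2)[η_𝟎 + log(1 + exp(−η_𝟎))] + (1/2)log(1 + exp(−η_{s₁}))`. -/
def netObj (N d : ℕ) (θ : ParamSpace N d) : ℝ :=
  (1 / 2) * (eta θ 0 + Real.log (1 + Real.exp (-eta θ 0)))
    + (1 / 2) * Real.log (1 + Real.exp (-eta θ (stdBasisOne d)))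


/-- The parameters with `W₁ = s E₁₁`, `W₂ = ⋯ = W_{N-1} = t E₁₁`, `W_N = 0` and no biases. -/
def cornerParam (N d : ℕ) [NeZero d] (s t : ℝ) : ParamSpace N d :=
  WithLp.toLp 2 (Sum.elim
    (fun p => if p.2.1 = 0 ∧ p.2.2 = 0 then (if (p.1 : ℕ) = 0 then s else t) else 0)
    (fun _ => 0))

theorem cornerParam_sub {N d : ℕ} [NeZero d] (hN : 0 < N - 1) (s s' t : ℝ) :
    cornerParam N d s t - cornerParam N d s' t =
      EuclideanSpace.single (Sum.inl (⟨0, hN⟩, 0, 0)) (s - s') := by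
  ext x
  rcases x with ⟨i, k, r⟩ | x
  · by_cases hi : (i : ℕ) = 0 <;> by_cases hk : k = 0 <;> by_cases hr : r = 0 <;>
      simp [cornerParam, ← Fin.val_inj (b := (⟨0, hN⟩ : Fin (N - 1))), hi, hk, hr]
  · simp [cornerParam]

theorem norm_cornerParam_sub {N d : ℕ} [NeZero d] (hN : 0 < N - 1) (s s' t : ℝ) :
    ‖cornerParam N d s t - cornerParam N d s' t‖ = |s - s'| := by
  simp [cornerParam_sub hN]

theorem cornerParam_add_smul_sub {N d : ℕ} [NeZero d] (s t u : ℝ) :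
    cornerParam N d 0 t + u • (cornerParam N d s t - cornerParam N d 0 t) =
      cornerParam N d (u * s) t := by
  ext x
  rcases x with ⟨i, k, r⟩ | x
  · by_cases hi : (i : ℕ) = 0 <;> by_cases h : k = 0 ∧ r = 0 <;>
      simp [cornerParam, hi, h]
  · simp [cornerParam]

theorem Wmat_cornerParam {N d : ℕ} [NeZero d] (s t : ℝ) {i : ℕ} (hi : i < N - 1) :
    Wmat (cornerParam N d s t) i = Matrix.single 0 0 (if i = 0 then s else t) := by
  ext k r
  simp [Wmat, hi, cornerParam, Matrix.single_apply, eq_comm]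

theorem bvec_cornerParam {N d : ℕ} [NeZero d] (s t : ℝ) (i : ℕ) :
    bvec (cornerParam N d s t) i = 0 := by
  ext r
  simp [bvec, cornerParam]

theorem layers_cornerParam {N d : ℕ} [NeZero d] (s t : ℝ) (z : Fin d → ℝ) (m : ℕ)
    (hm : m < N - 1) :
    layers (cornerParam N d s t) z (m + 1) = Pi.single 0 (s * t ^ m * z 0) := by
  induction m with
  | zero =>
    ext k
    rw [layers, bvec_cornerParam, Wmat_cornerParam s t hm]
    simp [layers, Matrix.single_mulVec, Function.update_apply, Pi.single_apply]
  | succ m ih =>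
    ext k
    rw [layers, bvec_cornerParam, Wmat_cornerParam s t hm, ih (by omega)]
    rw [Matrix.single_mulVec]
    by_cases hk : k = 0
    · simp [hk]
      ring
    · simp [hk]

theorem differentiable_layers {N d : ℕ} (z : Fin d → ℝ) (m : ℕ) (k : Fin d) :
    Differentiable ℝ (fun θ : ParamSpace N d => layers θ z m k) := by
  induction m generalizing k with
  | zero => exact differentiable_const _
  | succ m ih =>
    simp only [layers, Matrix.mulVec, dotProduct, Pi.add_apply, Wmat, bvec]
    by_cases hm : m < N - 1 <;> simp only [hm, dite_true, dite_false] <;> fun_prop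

/-- Where the output weight vanishes, only the output layer contributes to the derivative
of `eta`. -/
theorem hasFDerivAt_eta {N d : ℕ} (z : Fin d → ℝ) (θ : ParamSpace N d) (h : WNrow θ = 0) :
    HasFDerivAt (fun θ : ParamSpace N d => eta θ z)
      ((∑ r, layers θ z (N - 1) r • EuclideanSpace.proj (𝕜 := ℝ) (Sum.inr (Sum.inl r)) +
        EuclideanSpace.proj (𝕜 := ℝ) (Sum.inr (Sum.inr (Sum.inr ()))) :
          ParamSpace N d →L[ℝ] ℝ)) θ := by
  unfold eta
  refine HasFDerivAt.add (HasFDerivAt.fun_sum fun r _ => ?_)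
    (EuclideanSpace.proj (𝕜 := ℝ) (Sum.inr (Sum.inr (Sum.inr ())))).hasFDerivAt
  have hW : HasFDerivAt (fun θ : ParamSpace N d => WNrow θ r)
      (EuclideanSpace.proj (𝕜 := ℝ) (Sum.inr (Sum.inl r))) θ :=
    (EuclideanSpace.proj (𝕜 := ℝ) (Sum.inr (Sum.inl r))).hasFDerivAt
  have hmul := hW.mul (differentiable_layers z (N - 1) r θ).hasFDerivAt
  refine hmul.congr_fderiv ?_
  simp [congrFun h r]

theorem hasDerivAt_log_one_add_exp_neg_zero :
    HasDerivAt (fun x : ℝ => Real.log (1 + Real.exp (-x))) (-(1 / 2)) 0 := by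
  have h := (((hasDerivAt_id (0 : ℝ)).neg.exp).const_add 1).log (by simp)
  refine h.congr_deriv ?_
  simp
  norm_num

theorem gradient_netObj_cornerParam {N d : ℕ} [NeZero d] (hN : 2 ≤ N) (s t : ℝ) :
    gradient (netObj N d) (cornerParam N d s t) =
      EuclideanSpace.single (Sum.inr (Sum.inl 0)) (-(1 / 4) * (s * t ^ (N - 2))) := by
  have hW : WNrow (cornerParam N d s t) = 0 := by
    ext r
    simp [WNrow, cornerParam]
  have heta (z : Fin d → ℝ) : eta (cornerParam N d s t) z = 0 := by
    rw [eta, hW]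
    simp [bLast, cornerParam]
  have hlog (z : Fin d → ℝ) :=
    HasDerivAt.comp_hasFDerivAt_of_eq (cornerParam N d s t) hasDerivAt_log_one_add_exp_neg_zero
      (hasFDerivAt_eta z _ hW) (heta z).symm
  have hf := (((hasFDerivAt_eta 0 _ hW).add (hlog 0)).const_mul (1 / 2)).add
    ((hlog (stdBasisOne d)).const_mul (1 / 2))
  refine HasGradientAt.gradient (hasGradientAt_iff_hasFDerivAt.2 (hf.congr_fderiv ?_))
  have hlayers (z : Fin d → ℝ) : layers (cornerParam N d s t) z (N - 1) =
      Pi.single 0 (s * t ^ (N - 2) * z 0) := by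
    rw [← layers_cornerParam (N := N) s t z (N - 2) (by omega), show N - 2 + 1 = N - 1 by omega]
  ext v
  simp [hlayers, stdBasisOne, Pi.single_apply, EuclideanSpace.inner_single_left]
  ring

theorem norm_gradient_netObj_cornerParam {N d : ℕ} [NeZero d] (hN : 2 ≤ N) (s t : ℝ) :
    ‖gradient (netObj N d) (cornerParam N d s t)‖ = 1 / 4 * |s * t ^ (N - 2)| := by
  simp [gradient_netObj_cornerParam hN]

theorem norm_gradient_netObj_cornerParam_sub {N d : ℕ} [NeZero d] (hN : 2 ≤ N) (s t : ℝ) :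
    ‖gradient (netObj N d) (cornerParam N d 0 t) -
      gradient (netObj N d) (cornerParam N d s t)‖ = 1 / 4 * |s * t ^ (N - 2)| := by
  rw [gradient_netObj_cornerParam hN, gradient_netObj_cornerParam hN]
  rw [← dist_eq_norm, PiLp.dist_single_same]
  simp [Real.dist_eq]

/-- For `N ≥ 4`, `d ≥ 1`, and every `ρ ≥ 0`, the gradient of the deep
linear network objective is neither `ρ`-order Lipschitz continuous nor `ρ`-integrated
Lipschitz continuous, for any constants `C₀, C₁ ≥ 0`. -/
theorem net_grad_not_rho_lipschitz (N d : ℕ) (hN : 4 ≤ N) (hd : 1 ≤ d)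
    (ρ : ℝ) (hρ : 0 ≤ ρ) :
    (∀ C₀ C₁ : ℝ, 0 ≤ C₀ → 0 ≤ C₁ →
      ¬ (∀ θ : ParamSpace N d, ∃ r > 0, ∀ θ₁ ∈ ball θ r, ∀ θ₂ ∈ ball θ r,
        ‖gradient (netObj N d) θ₁ - gradient (netObj N d) θ₂‖ ≤
          (C₀ + C₁ * ‖gradient (netObj N d) θ‖ ^ ρ) * ‖θ₁ - θ₂‖)) ∧
    (∀ C₀ C₁ : ℝ, 0 ≤ C₀ → 0 ≤ C₁ →
      ¬ (∀ θ₁ θ₂ : ParamSpace N d,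
        ‖gradient (netObj N d) θ₁ - gradient (netObj N d) θ₂‖ ≤
          (C₀ + C₁ * ∫ t in (0:ℝ)..1,
              ‖gradient (netObj N d) (θ₁ + t • (θ₂ - θ₁))‖ ^ ρ) * ‖θ₁ - θ₂‖)) := by
  have : NeZero d := ⟨by omega⟩
  have hpow (K : ℝ) (hK : 0 ≤ K) : ∃ t : ℝ, 0 < t ∧ 4 * K < t ^ (N - 2) :=
    ⟨4 * K + 1, by positivity, (lt_add_one _).trans_le
      (le_self_pow₀ (by linarith) (by omega))⟩
  refine ⟨fun C₀ C₁ h₀ h₁ H => ?_, fun C₀ C₁ h₀ h₁ H => ?_⟩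
  · obtain ⟨t, ht, hlt⟩ := hpow (C₀ + C₁) (by positivity)
    obtain ⟨r, hr, H⟩ := H (cornerParam N d 0 t)
    have hball : cornerParam N d (r / 2) t ∈ ball (cornerParam N d 0 t) r := by
      rw [mem_ball, dist_eq_norm, norm_cornerParam_sub (by omega), sub_zero,
        abs_of_pos (half_pos hr)]
      exact half_lt_self hr
    have hineq := H _ (mem_ball_self hr) _ hball
    rw [norm_gradient_netObj_cornerParam_sub (by omega),
      norm_gradient_netObj_cornerParam (by omega), norm_cornerParam_sub (by omega),
      abs_of_pos (by positivity), zero_sub, abs_neg, abs_of_pos (half_pos hr), zero_mul,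
      abs_zero, mul_zero] at hineq
    have hle : C₁ * (0 : ℝ) ^ ρ ≤ C₁ :=
      mul_le_of_le_one_right h₁ (Real.rpow_le_one le_rfl zero_le_one hρ)
    nlinarith
  · obtain ⟨t, ht, hlt⟩ := hpow (C₀ + C₁) (by positivity)
    have htN : 0 < t ^ (N - 2) := by positivity
    set s := (t ^ (N - 2))⁻¹
    have hst : s * t ^ (N - 2) = 1 := inv_mul_cancel₀ htN.ne'
    have hs0 : 0 < s := inv_pos.2 htN
    have hineq := H (cornerParam N d 0 t) (cornerParam N d s t)
    simp only [cornerParam_add_smul_sub] at hineq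
    rw [norm_gradient_netObj_cornerParam_sub (by omega), hst, norm_cornerParam_sub (by omega),
      zero_sub, abs_neg, abs_of_pos hs0, abs_one] at hineq
    have hint : ∫ u in (0:ℝ)..1, ‖gradient (netObj N d) (cornerParam N d (u * s) t)‖ ^ ρ ≤ 1 := by
      refine (Real.le_norm_self _).trans (le_of_le_of_eq (b := 1 * |(1 : ℝ) - 0|)
        (intervalIntegral.norm_integral_le_of_norm_le_const fun u hu => ?_) (by simp))
      rw [Set.uIoc_of_le zero_le_one] at hu
      rw [norm_gradient_netObj_cornerParam (by omega), mul_assoc, hst, mul_one,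
        abs_of_pos hu.1, Real.norm_of_nonneg (Real.rpow_nonneg (by linarith [hu.1]) _)]
      exact Real.rpow_le_one (by linarith [hu.1]) (by linarith [hu.2]) hρ
    have hle := mul_le_of_le_one_right h₁ hint
    have hbound : 1 / 4 * 1 ≤ (C₀ + C₁) * s :=
      hineq.trans (mul_le_mul_of_nonneg_right (by linarith) hs0.le)
    nlinarith

end
end

section
/- Let N ≥ 4 and d ≥ 1 be integers, let f be the deep linear network objective f = (1/2)[η_𝟎 + log(1 + exp(−η_𝟎))] + (1/2)log(1 + exp(−η_{s₁})) with η_z = W_N(W_{N−1}(⋯(W₁z + b₁)⋯) + b_{N−1}) + b_N, and for an integer n > 2 define the parameter point xⁿ by W₁ = ⋯ = W_{N−2} = E₁₁, W_{N−1} = n·log(n)·E₁₁, W_N = n^{−1}s₁ᵀ, and b₁ = ⋯ = b_N = 0, where E₁₁ ∈ ℝ^{d×d} has a one in entry (1,1) and zeros elsewhere and s₁ is the first standard basis vector of ℝ^d. Then the squared Euclidean norm of the gradient satisfies ‖∇f(xⁿ)‖₂² = (n²(log n)² + n^{−2} + (N−2)(log n)²)/(4(1+n)²) + ((n−1)²(1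 + n^{−2} + (N−2)(log n)²))/(16(n+1)²), and (log n)²/16 ≤ ‖∇f(xⁿ)‖₂² ≤ N(log n)²/2. -/
open Metric

noncomputable section

theorem layers_succ_apply {N d : ℕ} (θ : ParamSpace N d) (z : Fin d → ℝ) (m : ℕ) (k : Fin d) :
    layers θ z (m + 1) k = (∑ r, Wmat θ m k r * layers θ z m r) + bvec θ m k := rfl

theorem hasFDerivAt_apply_paramSpace {N d : ℕ} (θ : ParamSpace N d) (p : ParamIdx N d) :
    HasFDerivAt (fun θ : ParamSpace N d => θ p)
      (EuclideanSpace.proj p : ParamSpace N d →L[ℝ] ℝ) θ :=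
  (EuclideanSpace.proj p : ParamSpace N d →L[ℝ] ℝ).hasFDerivAt

theorem differentiable_Wmat_apply {N d : ℕ} (i : ℕ) (k r : Fin d) :
    Differentiable ℝ fun θ : ParamSpace N d => Wmat θ i k r := by
  intro θ
  unfold Wmat
  split_ifs with h
  · exact (hasFDerivAt_apply_paramSpace θ _).differentiableAt
  · exact differentiableAt_const _

theorem fderiv_Wmat_apply {N d : ℕ} (θ v : ParamSpace N d) (i : ℕ) (k r : Fin d) :
    fderiv ℝ (fun θ : ParamSpace N d => Wmat θ i k r) θ v = Wmat v i k r := by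
  unfold Wmat
  split_ifs with h
  · rw [(hasFDerivAt_apply_paramSpace θ (Sum.inl (⟨i, h⟩, k, r))).fderiv]; rfl
  · simp

theorem differentiable_bvec_apply {N d : ℕ} (i : ℕ) (r : Fin d) :
    Differentiable ℝ fun θ : ParamSpace N d => bvec θ i r := by
  intro θ
  unfold bvec
  split_ifs with h
  · exact (hasFDerivAt_apply_paramSpace θ _).differentiableAt
  · exact differentiableAt_const _

theorem fderiv_bvec_apply {N d : ℕ} (θ v : ParamSpace N d) (i : ℕ) (r : Fin d) :
    fderiv ℝ (fun θ : ParamSpace N d => bvec θ i r) θ v = bvec v i r := by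
  unfold bvec
  split_ifs with h
  · rw [(hasFDerivAt_apply_paramSpace θ (Sum.inr (Sum.inr (Sum.inl (⟨i, h⟩, r))))).fderiv]; rfl
  · simp

theorem differentiable_layers_apply {N d : ℕ} (z : Fin d → ℝ) (m : ℕ) (k : Fin d) :
    Differentiable ℝ fun θ : ParamSpace N d => layers θ z m k := by
  induction m generalizing k with
  | zero => exact differentiable_const _
  | succ m ih =>
    simp only [layers_succ_apply]
    exact (Differentiable.fun_sum fun r _ => (differentiable_Wmat_apply m k r).mul (ih r)).add
      (differentiable_bvec_apply m k)

theorem fderiv_layers_succ_apply {N d : ℕ} (z : Fin d → ℝ) (m : ℕ) (k : Fin d)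
    (θ v : ParamSpace N d) :
    fderiv ℝ (fun θ : ParamSpace N d => layers θ z (m + 1) k) θ v =
      (∑ r, (Wmat θ m k r * fderiv ℝ (fun θ : ParamSpace N d => layers θ z m r) θ v
        + layers θ z m r * Wmat v m k r)) + bvec v m k := by
  have h : HasFDerivAt (fun θ : ParamSpace N d => layers θ z (m + 1) k) _ θ :=
    (HasFDerivAt.fun_sum (u := Finset.univ) fun r _ =>
      ((differentiable_Wmat_apply m k r) θ).hasFDerivAt.mul
        ((differentiable_layers_apply z m r) θ).hasFDerivAt).add
      ((differentiable_bvec_apply m k) θ).hasFDerivAt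
  rw [h.fderiv]
  simp [fderiv_Wmat_apply, fderiv_bvec_apply]

theorem differentiable_eta {N d : ℕ} (z : Fin d → ℝ) :
    Differentiable ℝ fun θ : ParamSpace N d => eta θ z := fun θ =>
  (DifferentiableAt.fun_sum fun r _ =>
    (hasFDerivAt_apply_paramSpace θ (Sum.inr (Sum.inl r))).differentiableAt.mul
      (differentiable_layers_apply z (N - 1) r θ)).add
    (hasFDerivAt_apply_paramSpace θ (Sum.inr (Sum.inr (Sum.inr ())))).differentiableAt

theorem fderiv_eta_apply {N d : ℕ} (z : Fin d → ℝ) (θ v : ParamSpace N d) :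
    fderiv ℝ (fun θ : ParamSpace N d => eta θ z) θ v =
      (∑ r, (WNrow θ r * fderiv ℝ (fun θ : ParamSpace N d => layers θ z (N - 1) r) θ v
        + layers θ z (N - 1) r * WNrow v r)) + bLast v := by
  have h : HasFDerivAt (fun θ : ParamSpace N d => eta θ z) _ θ :=
    (HasFDerivAt.fun_sum (u := Finset.univ) fun r _ =>
      (hasFDerivAt_apply_paramSpace θ (Sum.inr (Sum.inl r))).mul
        ((differentiable_layers_apply z (N - 1) r) θ).hasFDerivAt).add
      (hasFDerivAt_apply_paramSpace θ (Sum.inr (Sum.inr (Sum.inr ()))))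
  rw [h.fderiv]
  simp [WNrow, bLast]

/-- If every hidden weight is `w i • E₁₁` and every hidden bias vanishes, the hidden layers of the
input `a • s₁` stay on the first coordinate axis. -/
theorem layers_of_diagonal {N d : ℕ} {θ : ParamSpace N d} {w : ℕ → ℝ} (o : Fin d)
    (hW : ∀ i < N - 1, ∀ k r, Wmat θ i k r = if k = o ∧ r = o then w i else 0)
    (hb : ∀ i, bvec θ i = 0) (z : Fin d → ℝ) (a : ℝ) (hz : ∀ k, z k = if k = o then a else 0)
    (m : ℕ) (hm : m ≤ N - 1) (k : Fin d) :
    layers θ z m k = if k = o then a * ∏ i ∈ Finset.range m, w i else 0 := by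
  induction m generalizing k with
  | zero => simp [layers, hz]
  | succ m ih =>
    have ih' := ih (by omega)
    rw [layers_succ_apply, hb]
    simp only [ih', hW m (by omega), Finset.prod_range_succ]
    by_cases hk : k = o <;> simp [hk]
    ring

theorem fderiv_layers_succ_of_diagonal {N d : ℕ} {θ : ParamSpace N d} {w : ℕ → ℝ} (o : Fin d)
    (hW : ∀ i < N - 1, ∀ k r, Wmat θ i k r = if k = o ∧ r = o then w i else 0)
    (hb : ∀ i, bvec θ i = 0) (z : Fin d → ℝ) (a : ℝ) (hz : ∀ k, z k = if k = o then a else 0)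
    (m : ℕ) (hm : m < N - 1) (v : ParamSpace N d) :
    fderiv ℝ (fun θ : ParamSpace N d => layers θ z (m + 1) o) θ v =
      w m * fderiv ℝ (fun θ : ParamSpace N d => layers θ z m o) θ v
        + a * (∏ i ∈ Finset.range m, w i) * Wmat v m o o + bvec v m o := by
  rw [fderiv_layers_succ_apply]
  simp [hW m hm, layers_of_diagonal o hW hb z a hz m hm.le, Finset.sum_add_distrib]

/-- The derivative of the objective through those of the two network outputs. -/
theorem hasFDerivAt_netObj {N d : ℕ} (θ : ParamSpace N d) :
    HasFDerivAt (netObj N d)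
      ((1 / 2 * (1 + Real.exp (-eta θ 0))⁻¹) • fderiv ℝ (fun θ : ParamSpace N d => eta θ 0) θ
        - (1 / 2 * (1 + Real.exp (eta θ (stdBasisOne d)))⁻¹) •
          fderiv ℝ (fun θ : ParamSpace N d => eta θ (stdBasisOne d)) θ) θ := by
  have hlog (x : ℝ) : HasDerivAt (fun x => Real.log (1 + Real.exp (-x)))
      (-(1 + Real.exp x)⁻¹) x := by
    have h := (((hasDerivAt_neg x).exp).const_add 1).log (by positivity)
    convert h using 1
    rw [Real.exp_neg]
    field_simp
    ring
  have h0 := ((hasDerivAt_id (eta θ 0)).add (hlog (eta θ 0))).const_mul (1 / 2)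
  have h1 := (hlog (eta θ (stdBasisOne d))).const_mul (1 / 2)
  have h0' := h0.comp_hasFDerivAt θ (differentiable_eta 0 θ).hasFDerivAt
  have h1' := h1.comp_hasFDerivAt θ (differentiable_eta (stdBasisOne d) θ).hasFDerivAt
  refine (h0'.add h1').congr_fderiv ?_
  rw [sub_eq_add_neg, ← neg_smul]
  congr 2
  · rw [Real.exp_neg]
    field_simp
    ring
  · ring

/-- The vector of parameters whose weight blocks are `α` times, and whose bias blocks are `β` times,
the blocks supported on the coordinate `o` with values `c i`, `u` and `c i`, `1`. -/
def axisVec {N d : ℕ} (o : Fin d) (α β u : ℝ) (c : Fin (N - 1) → ℝ) : ParamSpace N d :=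
  WithLp.toLp 2 fun p => match p with
    | Sum.inl (i, k, r) => if k = o then if r = o then α * c i else 0 else 0
    | Sum.inr (Sum.inl r) => if r = o then α * u else 0
    | Sum.inr (Sum.inr (Sum.inl (i, r))) => if r = o then β * c i else 0
    | Sum.inr (Sum.inr (Sum.inr ())) => β

theorem inner_axisVec {N d : ℕ} (o : Fin d) (α β u : ℝ) (c : Fin (N - 1) → ℝ)
    (v : ParamSpace N d) :
    inner ℝ (axisVec o α β u c) v =
      α * ((∑ i, c i * Wmat v i o o) + u * WNrow v o)
        + β * ((∑ i, c i * bvec v i o) + bLast v) := by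
  simp [PiLp.inner_apply, axisVec, Fintype.sum_sum_type, Fintype.sum_prod_type, Wmat, WNrow, bvec,
    bLast, mul_add, Finset.mul_sum]
  simp only [mul_comm, mul_assoc, add_assoc]

theorem norm_sq_axisVec {N d : ℕ} (o : Fin d) (α β u : ℝ) (c : Fin (N - 1) → ℝ) :
    ‖(axisVec o α β u c : ParamSpace N d)‖ ^ 2 =
      α ^ 2 * ((∑ i, c i ^ 2) + u ^ 2) + β ^ 2 * ((∑ i, c i ^ 2) + 1) := by
  simp [EuclideanSpace.norm_sq_eq, axisVec, Fintype.sum_sum_type, Fintype.sum_prod_type, mul_add,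
    Finset.mul_sum, ite_pow, mul_pow]
  ring

/-- For `N ≥ 4`, `d ≥ 1`, `n > 2`, and the parameter point `θⁿ` given by
`W₁ = ⋯ = W_{N−2} = E₁₁`, `W_{N−1} = n·log(n)·E₁₁`, `W_N = n⁻¹s₁ᵀ`, `b₁ = ⋯ = b_N = 0`,
the squared Euclidean norm of the gradient of the objective equals
`(n²(log n)² + n⁻² + (N−2)(log n)²)/(4(1+n)²) + (n−1)²(1 + n⁻² + (N−2)(log n)²)/(16(n+1)²)`,
and `(log n)²/16 ≤ ‖∇f(θⁿ)‖² ≤ N(log n)²/2`. -/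
theorem net_grad_norm_at_sequence (N d : ℕ) (hN : 4 ≤ N) (hd : 1 ≤ d)
    (n : ℕ) (hn : 2 < n) (θ : ParamSpace N d)
    (hW : ∀ (i : Fin (N - 1)) (k r : Fin d),
      θ (Sum.inl (i, k, r)) =
        if (i : ℕ) = N - 2 then (if (k : ℕ) = 0 ∧ (r : ℕ) = 0 then (n : ℝ) * Real.log n else 0)
        else (if (k : ℕ) = 0 ∧ (r : ℕ) = 0 then 1 else 0))
    (hWN : ∀ r : Fin d, θ (Sum.inr (Sum.inl r)) = if (r : ℕ) = 0 then (n : ℝ)⁻¹ else 0)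
    (hb : ∀ (i : Fin (N - 1)) (r : Fin d), θ (Sum.inr (Sum.inr (Sum.inl (i, r)))) = 0)
    (hbN : θ (Sum.inr (Sum.inr (Sum.inr ()))) = 0) :
    ‖gradient (netObj N d) θ‖ ^ 2 =
      ((n : ℝ) ^ 2 * Real.log n ^ 2 + ((n : ℝ) ^ 2)⁻¹ + ((N : ℝ) - 2) * Real.log n ^ 2) /
          (4 * (1 + (n : ℝ)) ^ 2)
        + ((n : ℝ) - 1) ^ 2 * (1 + ((n : ℝ) ^ 2)⁻¹ + ((N : ℝ) - 2) * Real.log n ^ 2) /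
          (16 * ((n : ℝ) + 1) ^ 2) ∧
    Real.log n ^ 2 / 16 ≤ ‖gradient (netObj N d) θ‖ ^ 2 ∧
    ‖gradient (netObj N d) θ‖ ^ 2 ≤ (N : ℝ) * Real.log n ^ 2 / 2 := by
  obtain ⟨M, rfl⟩ : ∃ M, N = M + 2 := ⟨N - 2, by omega⟩
  set o : Fin d := ⟨0, hd⟩ with ho
  have ho' (k : Fin d) : (k : ℕ) = 0 ↔ k = o := by simp [ho, Fin.ext_iff]
  have hn0 : (3 : ℝ) ≤ n := by exact_mod_cast hn
  have hnz : (n : ℝ) ≠ 0 := by positivity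
  set L := Real.log n with hL
  have hL1 : 1 ≤ L := by
    rw [hL, Real.le_log_iff_exp_le (by positivity)]
    linarith [Real.exp_one_lt_d9]
  set w : ℕ → ℝ := fun i => if i = M then n * L else 1 with hw
  have hWθ : ∀ i < M + 2 - 1, ∀ k r, Wmat θ i k r = if k = o ∧ r = o then w i else 0 := by
    intro i hi k r
    simp only [Wmat, hi, dite_true, hW, ho', hw, Nat.add_sub_cancel]
    split_ifs <;> rfl
  have hbθ : ∀ i, bvec θ i = 0 := by
    intro i
    ext r
    simp [bvec, hb]
  have hNθ : ∀ r, WNrow θ r = if r = o then (n : ℝ)⁻¹ else 0 := by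
    intro r
    simp [WNrow, hWN, ho']
  have hbLθ : bLast θ = 0 := hbN
  have hprod (m : ℕ) (hm : m ≤ M) : ∏ i ∈ Finset.range m, w i = 1 :=
    Finset.prod_eq_one fun i hi => by
      have := Finset.mem_range.1 hi
      simp [hw, show i ≠ M by omega]
  have hprodM : ∏ i ∈ Finset.range (M + 1), w i = n * L := by
    rw [Finset.prod_range_succ, hprod M le_rfl]
    simp [hw]
  have heta (z : Fin d → ℝ) (a : ℝ) (hz : ∀ k, z k = if k = o then a else 0) :
      eta θ z = a * L := by
    have hl := layers_of_diagonal o hWθ hbθ z a hz (M + 1) le_rfl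
    simp only [eta, hNθ, hbLθ, show M + 2 - 1 = M + 1 from rfl, hl, hprodM]
    simp
    field_simp
  set c : Fin (M + 2 - 1) → ℝ := fun i => if (i : ℕ) = M then (n : ℝ)⁻¹ else L with hc
  have hsum (g : ℕ → ℝ → ℝ) : ∑ i : Fin (M + 2 - 1), g i (c i) =
      (∑ i ∈ Finset.range M, g i L) + g M (n : ℝ)⁻¹ := by
    rw [show ∑ i : Fin (M + 2 - 1), g i (c i) = ∑ i ∈ Finset.range (M + 1), g i (if i = M then (n : ℝ)⁻¹ else L) from
      Fin.sum_univ_eq_sum_range (fun i => g i (if i = M then (n : ℝ)⁻¹ else L)) (M + 1),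
      Finset.sum_range_succ]
    congr 1
    · refine Finset.sum_congr rfl fun i hi => ?_
      rw [if_neg (Finset.mem_range.1 hi).ne]
    · rw [if_pos rfl]
  have hdlayers (z : Fin d → ℝ) (a : ℝ) (hz : ∀ k, z k = if k = o then a else 0)
      (v : ParamSpace (M + 2) d) (m : ℕ) (hm : m ≤ M) :
      fderiv ℝ (fun θ : ParamSpace (M + 2) d => layers θ z m o) θ v =
        ∑ i ∈ Finset.range m, (a * Wmat v i o o + bvec v i o) := by
    induction m with
    | zero => simp [layers]
    | succ m ih =>
      rw [fderiv_layers_succ_of_diagonal o hWθ hbθ z a hz m (by omega), ih (by omega),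
        hprod m (by omega), Finset.sum_range_succ]
      simp [hw, show m ≠ M by omega]
      ring
  have hdeta (z : Fin d → ℝ) (a : ℝ) (hz : ∀ k, z k = if k = o then a else 0)
      (v : ParamSpace (M + 2) d) :
      fderiv ℝ (fun θ : ParamSpace (M + 2) d => eta θ z) θ v =
        a * ((∑ i, c i * Wmat v i o o) + n * L * WNrow v o)
          + ((∑ i, c i * bvec v i o) + bLast v) := by
    have hl := layers_of_diagonal o hWθ hbθ z a hz (M + 1) le_rfl
    have hd1 := fderiv_layers_succ_of_diagonal o hWθ hbθ z a hz M (by omega) v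
    rw [hdlayers z a hz v M le_rfl, hprod M le_rfl] at hd1
    rw [fderiv_eta_apply, hsum fun i x => x * Wmat v i o o, hsum fun i x => x * bvec v i o]
    simp only [hNθ, show M + 2 - 1 = M + 1 from rfl, hl, hprodM, ite_mul, zero_mul,
      Finset.sum_add_distrib, Finset.sum_ite_eq', Finset.mem_univ, if_true, hd1]
    simp only [hw, if_true, ← Finset.mul_sum]
    field_simp
    ring
  have hz0 : ∀ k : Fin d, (0 : Fin d → ℝ) k = if k = o then 0 else 0 := by simp
  have hz1 : ∀ k : Fin d, stdBasisOne d k = if k = o then 1 else 0 := by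
    simp [stdBasisOne, ho']
  have hgrad : HasGradientAt (netObj (M + 2) d)
      (axisVec o (-(1 / (2 * (1 + (n : ℝ))))) ((n - 1) / (4 * (n + 1))) (n * L) c) θ := by
    rw [hasGradientAt_iff_hasFDerivAt]
    refine (hasFDerivAt_netObj θ).congr_fderiv (ContinuousLinearMap.ext fun v => ?_)
    rw [InnerProductSpace.toDual_apply_apply, inner_axisVec, heta _ 0 hz0, heta _ 1 hz1]
    simp only [_root_.sub_apply, _root_.smul_apply, smul_eq_mul,
      hdeta _ 0 hz0, hdeta _ 1 hz1, zero_mul, one_mul, neg_zero, Real.exp_zero, zero_add]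
    rw [hL, Real.exp_log (by positivity)]
    field_simp
    ring
  have hval : ‖gradient (netObj (M + 2) d) θ‖ ^ 2 =
      ((n : ℝ) ^ 2 * L ^ 2 + ((n : ℝ) ^ 2)⁻¹ + M * L ^ 2) / (4 * (1 + (n : ℝ)) ^ 2)
        + ((n : ℝ) - 1) ^ 2 * (1 + ((n : ℝ) ^ 2)⁻¹ + M * L ^ 2) / (16 * ((n : ℝ) + 1) ^ 2) := by
    rw [hgrad.gradient, norm_sq_axisVec, hsum fun _ x => x ^ 2]
    simp only [Finset.sum_const, Finset.card_range, nsmul_eq_mul]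
    field_simp
    ring
  have hM : (2 : ℝ) ≤ M := by exact_mod_cast (by omega : 2 ≤ M)
  have hL2 : 1 ≤ L ^ 2 := one_le_pow₀ hL1
  have hinv : ((n : ℝ) ^ 2)⁻¹ ≤ 1 := inv_le_one_of_one_le₀ (one_le_pow₀ (by linarith))
  have hinv0 : 0 ≤ ((n : ℝ) ^ 2)⁻¹ := by positivity
  have hML : 0 ≤ M * L ^ 2 := by positivity
  rw [hval]
  refine ⟨by push_cast; ring, ?_, ?_⟩
  · have h1 : L ^ 2 / 16 ≤
        ((n : ℝ) ^ 2 * L ^ 2 + ((n : ℝ) ^ 2)⁻¹ + M * L ^ 2) / (4 * (1 + (n : ℝ)) ^ 2) := by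
      rw [div_le_div_iff₀ (by norm_num) (by positivity)]
      have : (1 + (n : ℝ)) ^ 2 ≤ 4 * n ^ 2 := by nlinarith
      nlinarith [mul_le_mul_of_nonneg_right this (sq_nonneg L)]
    have h2 : 0 ≤ ((n : ℝ) - 1) ^ 2 * (1 + ((n : ℝ) ^ 2)⁻¹ + M * L ^ 2) /
        (16 * ((n : ℝ) + 1) ^ 2) := by positivity
    linarith
  · have h1 : ((n : ℝ) ^ 2 * L ^ 2 + ((n : ℝ) ^ 2)⁻¹ + M * L ^ 2) / (4 * (1 + (n : ℝ)) ^ 2) ≤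
        L ^ 2 / 4 + (1 + M * L ^ 2) / 64 := by
      rw [div_le_iff₀ (by positivity)]
      have h16 : (16 : ℝ) ≤ (1 + n) ^ 2 := by nlinarith
      have : (n : ℝ) ^ 2 ≤ (1 + n) ^ 2 := by nlinarith
      nlinarith [mul_le_mul_of_nonneg_right this (sq_nonneg L),
        mul_le_mul_of_nonneg_right h16 (by positivity : 0 ≤ 1 + M * L ^ 2)]
    have h2 : ((n : ℝ) - 1) ^ 2 * (1 + ((n : ℝ) ^ 2)⁻¹ + M * L ^ 2) /
        (16 * ((n : ℝ) + 1) ^ 2) ≤ (2 + M * L ^ 2) / 16 := by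
      rw [div_le_div_iff₀ (by positivity) (by norm_num)]
      have : ((n : ℝ) - 1) ^ 2 ≤ (n + 1) ^ 2 := by nlinarith
      have := mul_le_mul this (by linarith : 1 + ((n : ℝ) ^ 2)⁻¹ + M * L ^ 2 ≤ 2 + M * L ^ 2)
        (by positivity) (by positivity)
      linarith
    push_cast
    nlinarith

end
end

section
/- Let N ≥ 4 and d ≥ 1 be integers, let f be the deep linear network objective f = (1/2)[η_𝟎 + log(1 + exp(−η_𝟎))] + (1/2)log(1 + exp(−η_{s₁})) with η_z = W_N(W_{N−1}(⋯(W₁z + b₁)⋯) + b_{N−1}) + b_N, and for an integer n ≥ 1 define the parameter point xⁿ by W₁ = ⋯ = W_{N−2} = E₁₁, W_{N−1} = n·log(n)·E₁₁, W_N = n^{−1}s₁ᵀ, and b₁ = ⋯ = b_N = 0, where E₁₁ ∈ ℝ^{d×d} has a one in entry (1,1) and zeros elsewhere and s₁ is the first standard basis vector of ℝ^d. Then the second partial derivative of f with respect to the entry W_N(1,1), evaluated at xⁿ, satisfies ∂²f/∂W_N(1,1)²(xⁿ) = (n/(2(1+n)²))·n²(log n)² ≥ n(log n)²/8. -/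
open Metric

noncomputable section

theorem fderiv_fderiv_apply_eq_deriv_deriv {E : Type*} [NormedAddCommGroup E] [NormedSpace ℝ E]
    {F : E → ℝ} (hF : ContDiff ℝ 2 F) (x v : E) :
    fderiv ℝ (fun y => fderiv ℝ F y v) x v =
      deriv (deriv fun t : ℝ => F (x + t • v)) 0 := by
  have hF₁ : Differentiable ℝ F := hF.differentiable (by norm_num)
  have hF₂ : Differentiable ℝ (fun y => fderiv ℝ F y v) :=
    ((hF.fderiv_right (m := 1) (by norm_num)).clm_apply contDiff_const).differentiable
      (by norm_num)
  rw [← (hF₂ x).lineDeriv_eq_fderiv, lineDeriv]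
  congr 1
  funext t
  rw [← (hF₁ _).lineDeriv_eq_fderiv, lineDeriv]
  have h := deriv_comp_const_add (fun t : ℝ => F (x + t • v)) t 0
  rw [add_zero] at h
  rw [← h]
  simp only [add_smul, add_assoc]

theorem contDiff_Wmat_apply {N d : ℕ} (i : ℕ) (k r : Fin d) :
    ContDiff ℝ 2 (fun θ : ParamSpace N d => Wmat θ i k r) := by
  unfold Wmat
  split_ifs <;> fun_prop

theorem contDiff_bvec_apply {N d : ℕ} (i : ℕ) (r : Fin d) :
    ContDiff ℝ 2 (fun θ : ParamSpace N d => bvec θ i r) := by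
  unfold bvec
  split_ifs <;> fun_prop

theorem contDiff_layers_apply {N d : ℕ} (z : Fin d → ℝ) (m : ℕ) (k : Fin d) :
    ContDiff ℝ 2 (fun θ : ParamSpace N d => layers θ z m k) := by
  induction m generalizing k with
  | zero => exact contDiff_const
  | succ m ih =>
    simp only [layers, Pi.add_apply, Matrix.mulVec, dotProduct]
    exact (ContDiff.sum fun r _ => (contDiff_Wmat_apply m k r).mul (ih r)).add
      (contDiff_bvec_apply m k)

theorem contDiff_eta {N d : ℕ} (z : Fin d → ℝ) :
    ContDiff ℝ 2 (fun θ : ParamSpace N d => eta θ z) := by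
  unfold eta
  refine (ContDiff.sum fun r _ => ContDiff.mul ?_ (contDiff_layers_apply z _ r)).add ?_
  · unfold WNrow
    fun_prop
  · unfold bLast
    fun_prop

theorem contDiff_netObj (N d : ℕ) : ContDiff ℝ 2 (netObj N d) := by
  have hlog : ∀ z : Fin d → ℝ,
      ContDiff ℝ 2 (fun θ : ParamSpace N d => Real.log (1 + Real.exp (-eta θ z))) := fun z =>
    (contDiff_const.add (contDiff_eta z).neg.exp).log fun θ => by positivity
  exact (contDiff_const.mul ((contDiff_eta 0).add (hlog 0))).add (contDiff_const.mul (hlog _))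

/-- The hidden layers do not depend on the output weights. -/
theorem layers_add_smul_single {N d : ℕ} (θ : ParamSpace N d) (j : Fin d) (t : ℝ)
    (z : Fin d → ℝ) (m : ℕ) :
    layers (θ + t • EuclideanSpace.single (Sum.inr (Sum.inl j)) 1) z m = layers θ z m := by
  induction m with
  | zero => rfl
  | succ m ih =>
    have hW : Wmat (θ + t • EuclideanSpace.single (Sum.inr (Sum.inl j)) 1) m = Wmat θ m := by
      ext k r
      simp [Wmat]
    have hb : bvec (θ + t • EuclideanSpace.single (Sum.inr (Sum.inl j)) 1) m = bvec θ m := by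
      ext r
      simp [bvec]
    simp only [layers, ih, hW, hb]

theorem eta_add_smul_single {N d : ℕ} (θ : ParamSpace N d) (j : Fin d) (t : ℝ)
    (z : Fin d → ℝ) :
    eta (θ + t • EuclideanSpace.single (Sum.inr (Sum.inl j)) 1) z =
      eta θ z + t * layers θ z (N - 1) j := by
  simp only [eta, layers_add_smul_single]
  simp [WNrow, bLast, add_mul, Finset.sum_add_distrib]
  ring

theorem mulVec_stdBasisOne {d : ℕ} (hd : 1 ≤ d) {M : Matrix (Fin d) (Fin d) ℝ} {a : ℝ}
    (hM : ∀ k r : Fin d, M k r = if (k : ℕ) = 0 ∧ (r : ℕ) = 0 then a else 0) (c : ℝ) :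
    M.mulVec (c • stdBasisOne d) = (a * c) • stdBasisOne d := by
  ext k
  rw [Matrix.mulVec, dotProduct, Finset.sum_eq_single (⟨0, hd⟩ : Fin d)]
  · by_cases hk : (k : ℕ) = 0 <;> simp [hM, stdBasisOne, hk]
  · intro r _ hr
    have : (r : ℕ) ≠ 0 := fun h => hr (Fin.ext h)
    simp [hM, this]
  · simp

theorem layers_zero {N d : ℕ} {θ : ParamSpace N d} (hb : ∀ i, bvec θ i = 0) (m : ℕ) :
    layers θ 0 m = 0 := by
  induction m with
  | zero => rfl
  | succ m ih => simp [layers, ih, hb]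

theorem hasDerivAt_log_one_add_exp_neg (a c t : ℝ) :
    HasDerivAt (fun t => Real.log (1 + Real.exp (-(a + t * c))))
      (-c / (1 + Real.exp (a + t * c))) t := by
  have h₁ : HasDerivAt (fun t => -(a + t * c)) (-c) t :=
    ((hasDerivAt_mul_const c).const_add a).fun_neg
  have h₂ := (h₁.exp.const_add 1).log (by positivity)
  convert h₂ using 1
  rw [Real.exp_neg]
  have := Real.exp_pos (a + t * c)
  field_simp
  ring

theorem hasDerivAt_neg_div_one_add_exp (a c t : ℝ) :
    HasDerivAt (fun t => -c / (1 + Real.exp (a + t * c)))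
      (c ^ 2 * Real.exp (a + t * c) / (1 + Real.exp (a + t * c)) ^ 2) t := by
  have h₁ : HasDerivAt (fun t => a + t * c) c t :=
    (hasDerivAt_mul_const c).const_add a
  have h₂ := (hasDerivAt_const t (-c)).fun_div (h₁.exp.const_add 1) (by positivity)
  refine h₂.congr_deriv ?_
  ring

theorem deriv_deriv_const_add_half_log (K a c : ℝ) :
    deriv (deriv fun t : ℝ => K + 1 / 2 * Real.log (1 + Real.exp (-(a + t * c)))) 0 =
      1 / 2 * (c ^ 2 * Real.exp a / (1 + Real.exp a) ^ 2) := by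
  have h : (deriv fun t : ℝ => K + 1 / 2 * Real.log (1 + Real.exp (-(a + t * c)))) =
      fun t => 1 / 2 * (-c / (1 + Real.exp (a + t * c))) :=
    funext fun t => (((hasDerivAt_log_one_add_exp_neg a c t).const_mul _).const_add K).deriv
  rw [h, ((hasDerivAt_neg_div_one_add_exp a c 0).const_mul _).deriv]
  simp

/-- For `N ≥ 4`, `d ≥ 1`, `n ≥ 1`, and the parameter point `θⁿ` given by
`W₁ = ⋯ = W_{N−2} = E₁₁`, `W_{N−1} = n·log(n)·E₁₁`, `W_N = n⁻¹s₁ᵀ`, `b₁ = ⋯ = b_N = 0`,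
the second partial derivative of the objective with respect to the entry `W_N(1,1)`
(the second directional derivative along the corresponding coordinate direction) equals
`(n/(2(1+n)²))·n²(log n)²`, which is at least `n(log n)²/8`. -/
theorem net_second_partial_at_sequence (N d : ℕ) (hN : 4 ≤ N) (hd : 1 ≤ d)
    (n : ℕ) (hn : 1 ≤ n) (θ : ParamSpace N d)
    (hW : ∀ (i : Fin (N - 1)) (k r : Fin d),
      θ (Sum.inl (i, k, r)) =
        if (i : ℕ) = N - 2 then (if (k : ℕ) = 0 ∧ (r : ℕ) = 0 then (n : ℝ) * Real.log n else 0)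
        else (if (k : ℕ) = 0 ∧ (r : ℕ) = 0 then 1 else 0))
    (hWN : ∀ r : Fin d, θ (Sum.inr (Sum.inl r)) = if (r : ℕ) = 0 then (n : ℝ)⁻¹ else 0)
    (hb : ∀ (i : Fin (N - 1)) (r : Fin d), θ (Sum.inr (Sum.inr (Sum.inl (i, r)))) = 0)
    (hbN : θ (Sum.inr (Sum.inr (Sum.inr ()))) = 0) :
    fderiv ℝ (fun θ' : ParamSpace N d => fderiv ℝ (netObj N d) θ'
        (EuclideanSpace.single (Sum.inr (Sum.inl ⟨0, hd⟩)) 1)) θ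
        (EuclideanSpace.single (Sum.inr (Sum.inl ⟨0, hd⟩)) 1) =
      ((n : ℝ) / (2 * (1 + (n : ℝ)) ^ 2)) * ((n : ℝ) ^ 2 * Real.log n ^ 2) ∧
    (n : ℝ) * Real.log n ^ 2 / 8 ≤
      ((n : ℝ) / (2 * (1 + (n : ℝ)) ^ 2)) * ((n : ℝ) ^ 2 * Real.log n ^ 2) := by
  have hn₀ : (1 : ℝ) ≤ n := by exact_mod_cast hn
  have hb' : ∀ i, bvec θ i = 0 := by
    intro i
    ext r
    simp [bvec, hb]
  have hlayers : ∀ m ≤ N - 2, layers θ (stdBasisOne d) m = (1 : ℝ) • stdBasisOne d := by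
    intro m
    induction m with
    | zero => simp [layers]
    | succ m ih =>
      intro hm
      rw [layers, ih (by omega), hb', mulVec_stdBasisOne hd (a := 1), mul_one, add_zero]
      intro k r
      rw [Wmat, dif_pos (by omega), hW, if_neg (by simp only; omega)]
  have hlast : layers θ (stdBasisOne d) (N - 1) = ((n : ℝ) * Real.log n) • stdBasisOne d := by
    obtain ⟨M, rfl⟩ : ∃ M, N = M + 2 := ⟨N - 2, by omega⟩
    change layers θ (stdBasisOne d) (M + 1) = _
    rw [layers, hlayers M (by omega), hb', mulVec_stdBasisOne hd (a := (n : ℝ) * Real.log n),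
      mul_one, add_zero]
    intro k r
    rw [Wmat, dif_pos (by omega), hW, if_pos (by simp)]
  have heta₀ : eta θ 0 = 0 := by
    simp [eta, layers_zero hb', bLast, hbN]
  have heta₁ : eta θ (stdBasisOne d) = Real.log n := by
    rw [eta, hlast, Finset.sum_eq_single (⟨0, hd⟩ : Fin d)]
    · simp only [WNrow, hWN, bLast, hbN, Pi.smul_apply, stdBasisOne, smul_eq_mul, if_true]
      field_simp
      ring
    · intro r _ hr
      have : (r : ℕ) ≠ 0 := fun h => hr (Fin.ext h)
      simp [stdBasisOne, this]
    · simp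
  refine ⟨?_, ?_⟩
  · rw [fderiv_fderiv_apply_eq_deriv_deriv (contDiff_netObj N d)]
    simp only [netObj, eta_add_smul_single, heta₀, heta₁, layers_zero hb', hlast, Pi.zero_apply,
      mul_zero, Pi.smul_apply, smul_eq_mul]
    rw [deriv_deriv_const_add_half_log, Real.exp_log (by positivity)]
    simp only [stdBasisOne, if_true]
    field_simp
  · rw [div_mul_eq_mul_div, div_le_div_iff₀ (by norm_num) (by positivity)]
    have h : (1 + (n : ℝ)) ^ 2 ≤ 4 * (n : ℝ) ^ 2 := by nlinarith
    have h' : 0 ≤ (n : ℝ) * Real.log n ^ 2 := by positivity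
    nlinarith [mul_le_mul_of_nonneg_left h h']

end
end
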